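/- For all integers n ≥ 1 and δ ≥ 1 there exists a constant c = c(n,δ) ≥ 0 with the following property. Suppose G is an almost torsion-free group with a finite generating set S of n elements whose Cayley graph X = Γ(G,S) is δ-hyperbolic. Then for every infinite subgroup U < G, the weak convex hull X_U and the convex hull X(U) (both formed in X relative to the constant δ) are c-Hausdorff close. -/

import Mathlib

noncomputable section

namespace KW

open Metric Set Pointwise

variable {X : Type*} [MetricSpace X]

/-- `s` is (the image of) a unit-speed geodesic segment joining `x` to `y`. -/
def IsGeodesicSegment (s : Set X) (x y : X) : Prop :=
  ∃ (b : ℝ) (f : ℝ → X), 0 ≤ b ∧ f 0 = x ∧ f b = y ∧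
    (∀ u ∈ Set.Icc (0 : ℝ) b, ∀ v ∈ Set.Icc (0 : ℝ) b, dist (f u) (f v) = |u - v|) ∧
    s = f '' Set.Icc 0 b

/-- A geodesic metric space. -/
def GeodesicSpace (X : Type*) [MetricSpace X] : Prop :=
  ∀ x y : X, ∃ s : Set X, IsGeodesicSegment s x y

/-- `X` is `δ`-hyperbolic: geodesic, and every geodesic triangle is `δ`-thin. -/
def DeltaHyperbolic (δ : ℝ) (X : Type*) [MetricSpace X] : Prop :=
  GeodesicSpace X ∧
    ∀ (x y z : X) (s₁ s₂ s₃ : Set X),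
      IsGeodesicSegment s₁ x y → IsGeodesicSegment s₂ y z → IsGeodesicSegment s₃ x z →
      ∀ p ∈ s₁, ∃ q ∈ s₂ ∪ s₃, dist p q ≤ δ

/-- `A` is an `ε`-quasiconvex subset of `X`. -/
def Quasiconvex (ε : ℝ) (A : Set X) : Prop :=
  ∀ x ∈ A, ∀ y ∈ A, ∀ s : Set X, IsGeodesicSegment s x y → ∀ p ∈ s, ∃ a ∈ A, dist p a ≤ ε

/-- The Gromov product `(y,z)_x`. -/
def gromov (x y z : X) : ℝ := (dist y x + dist z x - dist y z) / 2

def IsGeodesicRay (γ : ℝ → X) : Prop :=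
  ∀ s t : ℝ, 0 ≤ s → 0 ≤ t → dist (γ s) (γ t) = |s - t|

def IsBiGeodesic (γ : ℝ → X) : Prop :=
  ∀ s t : ℝ, dist (γ s) (γ t) = |s - t|

/-- `A` and `B` are `K`-Hausdorff close. -/
def HClose (K : ℝ) (A B : Set X) : Prop :=
  (∀ a ∈ A, ∃ b ∈ B, dist a b ≤ K) ∧ ∀ b ∈ B, ∃ a ∈ A, dist a b ≤ K

def HausdorffClose (A B : Set X) : Prop := ∃ K : ℝ, HClose K A B

/-- Two geodesic rays are asymptotic iff their images are Hausdorff close. -/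
def Asymptotic (γ γ' : ℝ → X) : Prop :=
  HausdorffClose (γ '' Set.Ici 0) (γ' '' Set.Ici 0)

def GRay (X : Type*) [MetricSpace X] : Type _ := {γ : ℝ → X // IsGeodesicRay γ}

theorem asymptotic_refl (γ : ℝ → X) : Asymptotic γ γ :=
  ⟨0, fun a ha => ⟨a, ha, by simp⟩, fun b hb => ⟨b, hb, by simp⟩⟩

theorem asymptotic_symm {γ γ' : ℝ → X} (h : Asymptotic γ γ') : Asymptotic γ' γ := by
  obtain ⟨K, h₁, h₂⟩ := h
  refine ⟨K, fun a ha => ?_, fun b hb => ?_⟩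
  · obtain ⟨b, hb, hd⟩ := h₂ a ha
    exact ⟨b, hb, by rwa [dist_comm]⟩
  · obtain ⟨a, ha, hd⟩ := h₁ b hb
    exact ⟨a, ha, by rwa [dist_comm]⟩

theorem asymptotic_trans {γ₁ γ₂ γ₃ : ℝ → X} (h : Asymptotic γ₁ γ₂)
    (h' : Asymptotic γ₂ γ₃) : Asymptotic γ₁ γ₃ := by
  obtain ⟨K, h₁, h₂⟩ := h
  obtain ⟨K', h₁', h₂'⟩ := h'
  refine ⟨K + K', fun a ha => ?_, fun c hc => ?_⟩
  · obtain ⟨b, hb, hab⟩ := h₁ a ha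
    obtain ⟨c, hc, hbc⟩ := h₁' b hb
    exact ⟨c, hc, (dist_triangle a b c).trans (by linarith)⟩
  · obtain ⟨b, hb, hbc⟩ := h₂' c hc
    obtain ⟨a, ha, hab⟩ := h₂ b hb
    exact ⟨a, ha, (dist_triangle a b c).trans (by linarith)⟩

def raySetoid (X : Type*) [MetricSpace X] : Setoid (GRay X) where
  r γ γ' := Asymptotic γ.1 γ'.1
  iseqv := ⟨fun γ => asymptotic_refl γ.1, fun h => asymptotic_symm h,
    fun h h' => asymptotic_trans h h'⟩

/-- The (geodesic) boundary of `X`: asymptoty classes of geodesic rays. -/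
def Boundary (X : Type*) [MetricSpace X] : Type _ := Quotient (raySetoid X)

def Boundary.mk {X : Type*} [MetricSpace X] (γ : GRay X) : Boundary X :=
  Quotient.mk (raySetoid X) γ

/-- A strongly geodesic metric space. -/
def StronglyGeodesic (X : Type*) [MetricSpace X] : Prop :=
  GeodesicSpace X ∧
  (∀ γ : ℝ → X, IsGeodesicRay γ → ∀ y : X,
      ∃ γ' : ℝ → X, IsGeodesicRay γ' ∧ γ' 0 = y ∧ Asymptotic γ γ') ∧
  (∀ γ₁ γ₂ : ℝ → X, IsGeodesicRay γ₁ → IsGeodesicRay γ₂ → γ₁ 0 = γ₂ 0 →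
      ¬ Asymptotic γ₁ γ₂ →
      ∃ γ : ℝ → X, IsBiGeodesic γ ∧
        HausdorffClose (Set.range γ) (γ₁ '' Set.Ici 0 ∪ γ₂ '' Set.Ici 0)) ∧
  (∀ (x : X) (u : ℕ → X),
      (∀ M : ℝ, ∃ N : ℕ, ∀ n, N ≤ n → ∀ m, N ≤ m → M ≤ gromov x (u n) (u m)) →
      ∃ γ : ℝ → X, IsGeodesicRay γ ∧ γ 0 = x ∧
        ∀ M : ℝ, ∃ N : ℕ, ∀ n, N ≤ n → ∀ m, N ≤ m → M ≤ gromov x (γ (n : ℝ)) (u m))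

/-- The sequence `u` converges to the boundary point `p`, with basepoint `x`. -/
def SeqConvTo (x : X) (u : ℕ → X) (p : Boundary X) : Prop :=
  ∃ γ : GRay X, Boundary.mk γ = p ∧
    ∀ M : ℝ, ∃ N : ℕ, ∀ n, N ≤ n → ∀ m, N ≤ m → M ≤ gromov x (u n) (γ.1 (m : ℝ))

/-- `γ` is a geodesic ray in the class of the boundary point `p`. -/
def RayTo (γ : ℝ → X) (p : Boundary X) : Prop :=
  ∃ h : IsGeodesicRay γ, Boundary.mk ⟨γ, h⟩ = p

/-- `γ` is a biinfinite geodesic whose two ends converge to `p` and `q`. -/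
def BiGeodesicJoins (γ : ℝ → X) (p q : Boundary X) : Prop :=
  IsBiGeodesic γ ∧ SeqConvTo (γ 0) (fun n => γ (-(n : ℝ))) p ∧
    SeqConvTo (γ 0) (fun n => γ (n : ℝ)) q

/-- `s` is (the image of) a geodesic joining two points of `X ∪ ∂X`. -/
def JoinSet : X ⊕ Boundary X → X ⊕ Boundary X → Set X → Prop
  | Sum.inl x, Sum.inl y, s => IsGeodesicSegment s x y
  | Sum.inl x, Sum.inr p, s => ∃ γ : ℝ → X, γ 0 = x ∧ RayTo γ p ∧ s = γ '' Set.Ici 0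
  | Sum.inr p, Sum.inl x, s => ∃ γ : ℝ → X, γ 0 = x ∧ RayTo γ p ∧ s = γ '' Set.Ici 0
  | Sum.inr p, Sum.inr q, s => ∃ γ : ℝ → X, BiGeodesicJoins γ p q ∧ s = Set.range γ

/-- The convex hull `Conv(A)` of a subset `A ⊆ X ∪ ∂X`. -/
def geoConv (A : Set (X ⊕ Boundary X)) : Set X :=
  {x | (∃ a : X, A = {Sum.inl a} ∧ x = a) ∨
    ∃ p ∈ A, ∃ q ∈ A, p ≠ q ∧ ∃ s : Set X, JoinSet p q s ∧ x ∈ s}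

/-- The distance between two subsets of `X`. -/
def setDist (A B : Set X) : ℝ := sInf (Set.image2 dist A B)

/-- `a` is a projection of `p` on `A` (relative to `δ`). -/
def IsProjection (δ : ℝ) (A : Set X) (p a : X) : Prop :=
  a ∈ A ∧ ∀ a' ∈ A, dist p a ≤ dist p a' + δ

/-- `f` restricted to `[0,L]` is a unit-speed geodesic from `x` to `y`. -/
def GeodParam (f : ℝ → X) (L : ℝ) (x y : X) : Prop :=
  0 ≤ L ∧ f 0 = x ∧ f L = y ∧
    ∀ u ∈ Set.Icc (0 : ℝ) L, ∀ v ∈ Set.Icc (0 : ℝ) L, dist (f u) (f v) = |u - v|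

/-- Concatenation of three paths, the first on `[0,a]`, the second on `[0,b]`. -/
def concat3 (f₁ f₂ f₃ : ℝ → X) (a b : ℝ) : ℝ → X := fun t =>
  if t ≤ a then f₁ t else if t ≤ a + b then f₂ (t - a) else f₃ (t - a - b)

/-- `f` is a `(lam, ε)`-quasigeodesic on `[a,b]`. -/
def QuasigeodesicOn (lam ε : ℝ) (f : ℝ → X) (a b : ℝ) : Prop :=
  ∀ s ∈ Set.Icc a b, ∀ t ∈ Set.Icc a b, |s - t| ≤ lam * dist (f s) (f t) + ε

/-- The action of `G` on `X` is by isometries. -/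
def IsometricAction (G Y : Type*) [Group G] [MetricSpace Y] [MulAction G Y] : Prop :=
  ∀ (g : G) (x y : Y), dist (g • x) (g • y) = dist x y

section GroupAction

variable {G : Type*} [Group G]

/-- The limit set `Λ(U) ⊆ ∂X` of a subgroup `U ≤ G`. -/
def limitSet (X : Type*) [MetricSpace X] [MulAction G X] (U : Subgroup G) :
    Set (Boundary X) :=
  {p | ∃ x₀ : X, ∃ u : ℕ → U, SeqConvTo x₀ (fun n => ((u n : G)) • x₀) p}

/-- The small displacement set `E(U)` (relative to `δ`). -/
def smallDispSet (X : Type*) [MetricSpace X] [MulAction G X] (δ : ℝ) (U : Subgroup G) :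
    Set X :=
  {x | ∃ u : G, u ∈ U ∧ u ≠ 1 ∧ dist x (u • x) ≤ 100 * δ}

/-- `Z(U) = Conv(Λ(U) ∪ E(U))`. -/
def ZSet (X : Type*) [MetricSpace X] [MulAction G X] (δ : ℝ) (U : Subgroup G) : Set X :=
  geoConv (Sum.inr '' limitSet X U ∪ Sum.inl '' smallDispSet X δ U)

/-- The convex hull `X(U)`: the closure of `Conv(Z(U))`. -/
def cHull (X : Type*) [MetricSpace X] [MulAction G X] (δ : ℝ) (U : Subgroup G) : Set X :=
  closure (geoConv (Sum.inl '' ZSet X δ U))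

/-- The weak convex hull `X_U = Conv(Λ(U))`. -/
def weakHull (X : Type*) [MetricSpace X] [MulAction G X] (U : Subgroup G) : Set X :=
  geoConv (Sum.inr '' limitSet X U)

/-- `l_V(g) = d(X(V), gX(V))`. -/
def lV (X : Type*) [MetricSpace X] [MulAction G X] (δ : ℝ) (V : Subgroup G) (g : G) : ℝ :=
  setDist (cHull X δ V) (g • cHull X δ V)

/-- The translation length of `g`. -/
def translationLength (X : Type*) [MetricSpace X] [MulAction G X] (g : G) : ℝ :=
  sInf (Set.range fun x : X => dist x (g • x))

/-- The asymptotic translation length of `g`. -/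
def asympTranslationLength (X : Type*) [MetricSpace X] [MulAction G X] (g : G) : ℝ :=
  Filter.liminf (fun n : ℕ => translationLength X (g ^ n) / (n : ℝ)) Filter.atTop

/-- An elementary move between `G`-tuples `(U₁,…,U_n; h₁,…,h_m)`. -/
def gMove {n m : ℕ} (M M' : (Fin n → Subgroup G) × (Fin m → G)) : Prop :=
  (M'.2 = M.2 ∧ ∃ (j : Fin n) (g : G),
      g ∈ Subgroup.closure (Set.range M.2 ∪ ⋃ i ∈ {i : Fin n | i ≠ j}, ((M.1 i : Set G))) ∧
      (∀ i, i ≠ j → M'.1 i = M.1 i) ∧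
      M'.1 j = Subgroup.map (MulAut.conj g).toMonoidHom (M.1 j)) ∨
  (M'.1 = M.1 ∧ ∃ (i : Fin m) (g₁ g₂ : G),
      g₁ ∈ Subgroup.closure (M.2 '' {j : Fin m | j ≠ i} ∪ ⋃ t, ((M.1 t : Set G))) ∧
      g₂ ∈ Subgroup.closure (M.2 '' {j : Fin m | j ≠ i} ∪ ⋃ t, ((M.1 t : Set G))) ∧
      (∀ j, j ≠ i → M'.2 j = M.2 j) ∧
      M'.2 i = g₁ * M.2 i * g₂)

/-- Equivalence of `G`-tuples: a finite chain of elementary moves. -/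
def gEquiv {n m : ℕ} :
    (Fin n → Subgroup G) × (Fin m → G) → (Fin n → Subgroup G) × (Fin m → G) → Prop :=
  Relation.ReflTransGen gMove

/-- The family of factors `U₁,…,U_n, F(h₁),…,F(h_m)`. -/
def FF {n : ℕ} (m : ℕ) (U : Fin n → Subgroup G) : Fin n ⊕ Fin m → Type _
  | Sum.inl j => ↥(U j)
  | Sum.inr _ => FreeGroup PUnit

instance ffGroup {n : ℕ} (m : ℕ) (U : Fin n → Subgroup G) :
    (i : Fin n ⊕ Fin m) → Group (FF m U i)
  | Sum.inl j => inferInstanceAs (Group ↥(U j))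
  | Sum.inr _ => inferInstanceAs (Group (FreeGroup PUnit))

def ffHoms {n m : ℕ} (U : Fin n → Subgroup G) (H : Fin m → G) :
    (i : Fin n ⊕ Fin m) → FF m U i →* G
  | Sum.inl j => (U j).subtype
  | Sum.inr j => FreeGroup.lift fun _ => H j

/-- The canonical homomorphism `U₁ ∗ ⋯ ∗ U_n ∗ F(H) → G`. -/
def freeProdHom {n m : ℕ} (U : Fin n → Subgroup G) (H : Fin m → G) :
    Monoid.CoprodI (FF m U) →* G :=
  Monoid.CoprodI.lift (ffHoms U H)

/-- `W = U₁ ∗ ⋯ ∗ U_n ∗ F(H)`: the canonical homomorphism is injective with image `W`. -/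
def IsFreeProdDecomp {n m : ℕ} (U : Fin n → Subgroup G) (H : Fin m → G)
    (W : Subgroup G) : Prop :=
  Function.Injective (freeProdHom U H) ∧ (freeProdHom U H).range = W

/-- Minimality of the `G`-pair `(V; H)` (relative to a `1`-hyperbolic `G`-space `X`). -/
def PairMinimal (X : Type*) [MetricSpace X] [MulAction G X] {m : ℕ}
    (V : Subgroup G) (H : Fin m → G) : Prop :=
  ∀ (V' : Subgroup G) (H' : Fin m → G),
    gEquiv ((fun _ : Fin 1 => V), H) ((fun _ : Fin 1 => V'), H') →
    (∑ i, lV X 1 V (H i)) ≤ (∑ i, lV X 1 V' (H' i)) + 1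

/-- An elementary Nielsen move on tuples of elements of `G`. -/
def NielsenMove {k : ℕ} (g g' : Fin k → G) : Prop :=
  (∃ i : Fin k, (∀ j, j ≠ i → g' j = g j) ∧ g' i = (g i)⁻¹) ∨
  (∃ i j : Fin k, i ≠ j ∧ (∀ t, t ≠ i → g' t = g t) ∧ g' i = g i * g j) ∨
  (∃ i j : Fin k, i ≠ j ∧ g' = g ∘ Equiv.swap i j)

/-- Nielsen equivalence: a finite chain of elementary Nielsen moves. -/
def NielsenEq {k : ℕ} : (Fin k → G) → (Fin k → G) → Prop :=
  Relation.ReflTransGen NielsenMove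

/-- Word length of `g` with respect to the (symmetrized) generating set `S`. -/
def wordLength (S : Set G) (g : G) : ℕ :=
  sInf {n : ℕ | ∃ f : Fin n → G, (∀ i, f i ∈ S ∨ (f i)⁻¹ ∈ S) ∧ (List.ofFn f).prod = g}

/-- `(X, ι)` is a model of the Cayley graph `Γ(G,S)`. -/
def IsCayleyGraph (G : Type*) [Group G] (S : Set G) (X : Type*) [MetricSpace X]
    [MulAction G X] (ι : G → X) : Prop :=
  IsometricAction G X ∧
  (∀ g h : G, ι (g * h) = g • ι h) ∧
  Function.Injective ι ∧
  GeodesicSpace X ∧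
  (∀ g h : G, dist (ι g) (ι h) = (wordLength S (g⁻¹ * h) : ℝ)) ∧
  ∀ x : X, ∃ g h : G, wordLength S (g⁻¹ * h) ≤ 1 ∧
    ∃ s : Set X, IsGeodesicSegment s (ι g) (ι h) ∧ x ∈ s

/-- `H` is a quasiconvex subgroup (with respect to the Cayley graph model `(X, ι)`). -/
def QCSubgroup (X : Type*) [MetricSpace X] (ι : G → X) (H : Subgroup G) : Prop :=
  ∃ ε : ℝ, 0 ≤ ε ∧ Quasiconvex ε (ι '' (H : Set G))

end GroupAction

/-- Every nontrivial element of finite order has finite centralizer. -/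
def AlmostTorsionFree (G : Type*) [Group G] : Prop :=
  ∀ g : G, g ≠ 1 → IsOfFinOrder g → ((Subgroup.centralizer {g} : Subgroup G) : Set G).Finite

/-- `U` is nontrivial and admits no nontrivial free product decomposition. -/
def FreelyIndecomposable (U : Type*) [Group U] : Prop :=
  Nontrivial U ∧
    ¬ ∃ A B : Subgroup U, A ≠ ⊥ ∧ B ≠ ⊥ ∧
        Function.Bijective (Monoid.Coprod.lift A.subtype B.subtype)

def InfiniteCyclic (U : Type*) [Group U] : Prop := Infinite U ∧ IsCyclic U

def VirtuallyCyclic (U : Type*) [Group U] : Prop :=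
  ∃ H : Subgroup U, H.index ≠ 0 ∧ IsCyclic ↥H

def NonElementary (U : Type*) [Group U] : Prop := ¬ Finite U ∧ ¬ VirtuallyCyclic U

end KW

universe u v

namespace KW

open Pointwise Metric Set

section Hyp
variable {X : Type*} [MetricSpace X]

theorem seg_of_iso {f : ℝ → X} {a b : ℝ} (hab : a ≤ b)
    (hf : ∀ u ∈ Icc a b, ∀ v ∈ Icc a b, dist (f u) (f v) = |u - v|) :
    IsGeodesicSegment (f '' Icc a b) (f a) (f b) := by
  refine ⟨b - a, fun t => f (a + t), by linarith, by simp, by simp, ?_, ?_⟩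
  · intro u hu v hv
    rw [hf (a + u) ⟨by linarith [hu.1], by linarith [hu.2]⟩ (a + v)
      ⟨by linarith [hv.1], by linarith [hv.2]⟩]
    congr 1; ring
  · ext p; constructor
    · rintro ⟨t, ht, rfl⟩
      exact ⟨t - a, ⟨by linarith [ht.1], by linarith [ht.2]⟩, by simp⟩
    · rintro ⟨t, ht, rfl⟩
      exact ⟨a + t, ⟨by linarith [ht.1], by linarith [ht.2]⟩, rfl⟩

theorem seg_symm {s : Set X} {x y : X} (h : IsGeodesicSegment s x y) :
    IsGeodesicSegment s y x := by
  obtain ⟨b, f, hb, h0, h1, hf, rfl⟩ := h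
  refine ⟨b, fun t => f (b - t), hb, by simpa using h1, by simpa using h0, ?_, ?_⟩
  · intro u hu v hv
    rw [hf (b - u) ⟨by linarith [hu.2], by linarith [hu.1]⟩ (b - v)
      ⟨by linarith [hv.2], by linarith [hv.1]⟩, abs_sub_comm]
    congr 1; ring
  · ext p; constructor
    · rintro ⟨t, ht, rfl⟩
      exact ⟨b - t, ⟨by linarith [ht.2], by linarith [ht.1]⟩, by simp⟩
    · rintro ⟨t, ht, rfl⟩
      exact ⟨b - t, ⟨by linarith [ht.2], by linarith [ht.1]⟩, rfl⟩

theorem seg_left {s : Set X} {x y : X} (h : IsGeodesicSegment s x y) : x ∈ s := by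
  obtain ⟨b, f, hb, h0, h1, hf, rfl⟩ := h
  exact ⟨0, ⟨le_rfl, hb⟩, h0⟩

theorem seg_right {s : Set X} {x y : X} (h : IsGeodesicSegment s x y) : y ∈ s :=
  seg_left (seg_symm h)

theorem seg_param {s : Set X} {x y : X} (h : IsGeodesicSegment s x y) :
    ∃ f : ℝ → X, f 0 = x ∧ f (dist x y) = y ∧
    (∀ u ∈ Icc 0 (dist x y), ∀ v ∈ Icc 0 (dist x y), dist (f u) (f v) = |u - v|) ∧
    s = f '' Icc 0 (dist x y) := by
  obtain ⟨b, f, hb, h0, h1, hf, rfl⟩ := h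
  have : dist x y = b := by
    rw [← h0, ← h1, hf 0 ⟨le_rfl, hb⟩ b ⟨hb, le_rfl⟩]; simp [abs_of_nonneg hb]
  rw [this]
  exact ⟨f, h0, h1, hf, rfl⟩

theorem seg_add {s : Set X} {x y p : X} (h : IsGeodesicSegment s x y) (hp : p ∈ s) :
    dist x p + dist p y = dist x y := by
  obtain ⟨f, h0, h1, hf, hs⟩ := seg_param h
  rw [hs] at hp
  obtain ⟨t, ht, rfl⟩ := hp
  have e1 := hf 0 ⟨le_rfl, dist_nonneg⟩ t ht
  have e2 := hf t ht _ ⟨dist_nonneg, le_rfl⟩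
  rw [h0] at e1
  rw [h1] at e2
  rw [e1, e2, abs_sub_comm, abs_of_nonneg (by linarith [ht.1]), abs_sub_comm,
    abs_of_nonneg (by linarith [ht.2])]
  ring

theorem seg_dist {s : Set X} {x y p q : X} (h : IsGeodesicSegment s x y) (hp : p ∈ s)
    (hq : q ∈ s) : dist p q = |dist x p - dist x q| := by
  obtain ⟨f, h0, h1, hf, hs⟩ := seg_param h
  rw [hs] at hp hq
  obtain ⟨t, ht, rfl⟩ := hp
  obtain ⟨t', ht', rfl⟩ := hq
  have e1 := hf 0 ⟨le_rfl, dist_nonneg⟩ t ht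
  have e2 := hf 0 ⟨le_rfl, dist_nonneg⟩ t' ht'
  rw [h0] at e1 e2
  rw [e1, e2, hf t ht t' ht', zero_sub, zero_sub, abs_neg, abs_neg, abs_of_nonneg ht.1,
    abs_of_nonneg ht'.1]

theorem seg_point {s : Set X} {x y : X} (h : IsGeodesicSegment s x y) {t : ℝ} (h0 : 0 ≤ t)
    (h1 : t ≤ dist x y) : ∃ p ∈ s, dist x p = t := by
  obtain ⟨f, e0, e1, hf, hs⟩ := seg_param h
  refine ⟨f t, hs ▸ ⟨t, ⟨h0, h1⟩, rfl⟩, ?_⟩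
  have := hf 0 ⟨le_rfl, dist_nonneg⟩ t ⟨h0, h1⟩
  rw [e0] at this
  rw [this]; simp [abs_of_nonneg h0]

/-- slim quadrilaterals -/
theorem quad_full {δ : ℝ} (H : DeltaHyperbolic δ X) {x y x' y' p : X} {s sx sy s' : Set X}
    (hs : IsGeodesicSegment s x y) (hsx : IsGeodesicSegment sx x x')
    (hsy : IsGeodesicSegment sy y y') (hs' : IsGeodesicSegment s' x' y') (hp : p ∈ s)
    (hδ : 0 ≤ δ) :
    (∃ q ∈ s', dist p q ≤ 2 * δ) ∨ (∃ q ∈ sx, dist p q ≤ 2 * δ) ∨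
      (∃ q ∈ sy, dist p q ≤ 2 * δ) := by
  obtain ⟨t, ht⟩ := H.1 y x'
  obtain ⟨q, hq, hpq⟩ := H.2 x y x' s t sx hs ht hsx p hp
  rcases hq with hq | hq
  · obtain ⟨r, hr, hqr⟩ := H.2 y x' y' t s' sy ht hs' hsy q hq
    have : dist p r ≤ 2 * δ := by linarith [dist_triangle p q r]
    rcases hr with hr | hr
    · exact Or.inl ⟨r, hr, this⟩
    · exact Or.inr (Or.inr ⟨r, hr, this⟩)
  · exact Or.inr (Or.inl ⟨q, hq, by linarith⟩)

theorem quad3 {δ : ℝ} (H : DeltaHyperbolic δ X) {x y x' y' p : X} {s sy s' : Set X}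
    (hs : IsGeodesicSegment s x y)
    (hsy : IsGeodesicSegment sy y y') (hs' : IsGeodesicSegment s' x' y') (hp : p ∈ s)
    (hδ : 0 ≤ δ) :
    (∃ q ∈ s', dist p q ≤ 2 * δ) ∨ dist p x ≤ dist x x' + 2 * δ ∨
      (∃ q ∈ sy, dist p q ≤ 2 * δ) := by
  obtain ⟨sx, hsx⟩ := H.1 x x'
  rcases quad_full H hs hsx hsy hs' hp hδ with h | ⟨q, hq, h⟩ | h
  · exact Or.inl h
  · refine Or.inr (Or.inl ?_)
    have := seg_add hsx hq
    have := dist_triangle p q x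
    rw [dist_comm q x] at this
    linarith [dist_nonneg (x := q) (y := x')]
  · exact Or.inr (Or.inr h)

theorem quad {δ : ℝ} (H : DeltaHyperbolic δ X) {x y x' y' p : X} {s s' : Set X}
    (hs : IsGeodesicSegment s x y)
    (hs' : IsGeodesicSegment s' x' y') (hp : p ∈ s) (hδ : 0 ≤ δ) :
    (∃ q ∈ s', dist p q ≤ 2 * δ) ∨ dist p x ≤ dist x x' + 2 * δ ∨
      dist p y ≤ dist y y' + 2 * δ := by
  obtain ⟨sy, hsy⟩ := H.1 y y'
  rcases quad3 H hs hsy hs' hp hδ with h | h | ⟨q, hq, h⟩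
  · exact Or.inl h
  · exact Or.inr (Or.inl h)
  · refine Or.inr (Or.inr ?_)
    have := seg_add hsy hq
    have := dist_triangle p q y
    rw [dist_comm q y] at this
    linarith [dist_nonneg (x := q) (y := y')]

theorem quad_max {δ : ℝ} (H : DeltaHyperbolic δ X) {x y x' y' p : X} {s s' : Set X}
    (hs : IsGeodesicSegment s x y)
    (hs' : IsGeodesicSegment s' x' y') (hp : p ∈ s) (hδ : 0 ≤ δ) {R : ℝ}
    (hx : dist x x' ≤ R) (hy : dist y y' ≤ R) :
    ∃ q ∈ s', dist p q ≤ 2 * δ + R := by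
  have hR : 0 ≤ R := dist_nonneg.trans hx
  obtain ⟨sx, hsx⟩ := H.1 x x'
  obtain ⟨sy, hsy⟩ := H.1 y y'
  rcases quad_full H hs hsx hsy hs' hp hδ with ⟨q, hq, h⟩ | ⟨q, hq, h⟩ | ⟨q, hq, h⟩
  · exact ⟨q, hq, by linarith⟩
  · refine ⟨x', seg_left hs', ?_⟩
    have := seg_add hsx hq
    have := dist_triangle p q x'
    linarith [dist_nonneg (x := x) (y := q)]
  · refine ⟨y', seg_right hs', ?_⟩
    have := seg_add hsy hq
    have := dist_triangle p q y'
    linarith [dist_nonneg (x := y) (y := q)]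

theorem ray_seg {γ : ℝ → X} (h : IsGeodesicRay γ) {a b : ℝ} (ha : 0 ≤ a) (hab : a ≤ b) :
    IsGeodesicSegment (γ '' Icc a b) (γ a) (γ b) :=
  seg_of_iso hab fun u hu v hv => h u v (ha.trans hu.1) (ha.trans hv.1)

theorem ray_dist0 {γ : ℝ → X} (h : IsGeodesicRay γ) {t : ℝ} (ht : 0 ≤ t) :
    dist (γ 0) (γ t) = t := by
  rw [h 0 t le_rfl ht]; simp [abs_of_nonneg ht]

theorem ray_dist {γ : ℝ → X} (h : IsGeodesicRay γ) {s t : ℝ} (hs : 0 ≤ s) (ht : s ≤ t) :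
    dist (γ s) (γ t) = t - s := by
  rw [h s t hs (hs.trans ht), abs_sub_comm, abs_of_nonneg (by linarith)]

theorem asymp_of_near {δ : ℝ} (H : DeltaHyperbolic δ X) (hδ : 0 ≤ δ) {α β : ℝ → X}
    (hα : IsGeodesicRay α) (hβ : IsGeodesicRay β) {K : ℝ}
    (h : ∀ t, 0 ≤ t → ∃ s, 0 ≤ s ∧ dist (α t) (β s) ≤ K) : Asymptotic α β := by
  have hK : 0 ≤ K := by
    obtain ⟨s, -, hs⟩ := h 0 le_rfl
    exact dist_nonneg.trans hs
  set d := dist (α 0) (β 0) with hd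
  refine ⟨2 * K + 2 * d + 2 * δ, ?_, ?_⟩
  · rintro _ ⟨t, ht, rfl⟩
    obtain ⟨s, hs, hts⟩ := h t ht
    exact ⟨β s, ⟨s, hs, rfl⟩, by linarith [dist_nonneg (x := α 0) (y := β 0)]⟩
  · rintro _ ⟨t, ht, rfl⟩
    have ht : 0 ≤ t := ht
    have hd0 : 0 ≤ d := dist_nonneg
    set T := t + d + 2 * K + 2 * δ + 1 with hT
    have hT0 : 0 ≤ T := by positivity
    obtain ⟨s, hs, hTs⟩ := h T hT0
    have h1 := ray_dist0 hα hT0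
    have h2 := ray_dist0 hβ hs
    have h3 : T ≤ s + d + K := by
      have := dist_triangle4 (α 0) (β 0) (β s) (α T)
      rw [dist_comm (β s)] at this
      linarith
    have hts : t ≤ s := by linarith
    have := quad H (p := β t) (ray_seg hβ le_rfl hs) (ray_seg hα le_rfl hT0)
      ⟨t, ⟨ht, hts⟩, rfl⟩ hδ
    rcases this with ⟨q, ⟨r, hr, rfl⟩, hq⟩ | hq | hq
    · exact ⟨α r, ⟨r, hr.1, rfl⟩, by rw [dist_comm]; linarith⟩
    · refine ⟨α 0, ⟨0, self_mem_Ici, rfl⟩, ?_⟩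
      have := dist_triangle (α 0) (β 0) (β t)
      rw [dist_comm (β t), dist_comm (β 0) (α 0)] at hq
      linarith
    · rw [ray_dist hβ ht hts, dist_comm] at hq
      linarith

theorem gromov_le_seg {x a b q : X} {s : Set X} (hs : IsGeodesicSegment s a b) (hq : q ∈ s) :
    gromov x a b ≤ dist x q := by
  have := seg_add hs hq
  unfold gromov
  have h1 := dist_triangle a q x
  have h2 := dist_triangle b q x
  rw [dist_comm q x] at h1 h2
  rw [dist_comm b q] at h2
  linarith

theorem not_asymp_point {δ : ℝ} (H : DeltaHyperbolic δ X) (hδ : 0 ≤ δ) {α β : ℝ → X}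
    (hα : IsGeodesicRay α) (hβ : IsGeodesicRay β) (h : ¬ Asymptotic α β) :
    ∃ t, 0 ≤ t ∧ ∀ n m, t ≤ n → 0 ≤ m → ∀ s, IsGeodesicSegment s (α n) (β m) →
      ∃ q ∈ s, dist (α t) q ≤ 2 * δ := by
  by_contra hcon
  push Not at hcon
  refine h (asymp_of_near H hδ hα hβ (K := 2 * dist (α 0) (β 0) + 2 * δ) ?_)
  intro t ht
  obtain ⟨n, m, hn, hm, s, hs, hq⟩ := hcon t ht
  rcases quad3 H (p := α t) (ray_seg hα le_rfl (ht.trans hn)) hs (ray_seg hβ le_rfl hm)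
    ⟨t, ⟨ht, hn⟩, rfl⟩ hδ with ⟨q, ⟨r, hr, rfl⟩, h⟩ | h | ⟨q, hqs, h⟩
  · exact ⟨r, hr.1, by linarith [dist_nonneg (x := α 0) (y := β 0)]⟩
  · refine ⟨0, le_rfl, ?_⟩
    have := dist_triangle (α t) (α 0) (β 0)
    linarith
  · exact absurd h (not_le.2 (hq q hqs))

theorem asymp_of_gromov {δ : ℝ} (H : DeltaHyperbolic δ X) (hδ : 0 ≤ δ) {α β : ℝ → X}
    (hα : IsGeodesicRay α) (hβ : IsGeodesicRay β) (x : X)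
    (h : ∀ M : ℝ, ∃ N : ℕ, ∀ n, N ≤ n → ∀ m, N ≤ m → M ≤ gromov x (α (n : ℝ)) (β (m : ℝ))) :
    Asymptotic α β := by
  by_contra hcon
  obtain ⟨t, ht, hq⟩ := not_asymp_point H hδ hα hβ hcon
  obtain ⟨N, hN⟩ := h (dist x (α t) + 2 * δ + 1)
  set n := max N ⌈t⌉₊ with hn
  have h1 := hN n (le_max_left _ _) n (le_max_left _ _)
  have htn : t ≤ (n : ℝ) := (Nat.le_ceil t).trans (by exact_mod_cast le_max_right _ _)
  obtain ⟨s, hs⟩ := H.1 (α n) (β n)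
  obtain ⟨q, hqs, hd⟩ := hq n n htn (by positivity) s hs
  have := gromov_le_seg (x := x) hs hqs
  linarith [dist_triangle x (α t) q]

/-- asymptotic rays: thin ideal triangles -/
theorem asymp_thin {δ : ℝ} (H : DeltaHyperbolic δ X) (hδ : 0 ≤ δ) {α β : ℝ → X}
    (hα : IsGeodesicRay α) (hβ : IsGeodesicRay β) (h : Asymptotic α β) {s : Set X}
    (hs : IsGeodesicSegment s (α 0) (β 0)) {p : X} (hp : p ∈ s) :
    ∃ q ∈ α '' Ici 0 ∪ β '' Ici 0, dist p q ≤ 2 * δ := by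
  obtain ⟨K, hK, -⟩ := h
  have hK0 : 0 ≤ K := by
    obtain ⟨b, hb, hd⟩ := hK (α 0) ⟨0, self_mem_Ici, rfl⟩
    exact dist_nonneg.trans hd
  set T := dist (α 0) (β 0) + K + 2 * δ + 1 with hT
  have hT0 : 0 ≤ T := by positivity
  obtain ⟨_, ⟨T', hT', rfl⟩, hd⟩ := hK (α T) ⟨T, hT0, rfl⟩
  obtain ⟨s', hs'⟩ := H.1 (α T) (β T')
  rcases quad_full H hs (ray_seg hα le_rfl hT0) (ray_seg hβ le_rfl hT') hs' hp hδ with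
    ⟨q, hq, h⟩ | ⟨q, ⟨r, hr, rfl⟩, h⟩ | ⟨q, ⟨r, hr, rfl⟩, h⟩
  · exfalso
    have h1 := seg_add hs' hq
    have h2 := seg_add hs hp
    have h3 := ray_dist0 hα hT0
    have h4 := dist_triangle4 (α 0) p q (α T)
    rw [dist_comm q] at h4
    linarith [dist_nonneg (x := q) (y := β T'), dist_nonneg (x := p) (y := β 0)]
  · exact ⟨_, Or.inl ⟨r, hr.1, rfl⟩, h⟩
  · exact ⟨_, Or.inr ⟨r, hr.1, rfl⟩, h⟩

theorem near_gromov {δ : ℝ} (H : DeltaHyperbolic δ X) (hδ : 0 ≤ δ) {w x z : X} {s : Set X}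
    (hs : IsGeodesicSegment s x z) : ∃ p ∈ s, dist w p ≤ gromov w x z + 2 * δ + 1 := by
  obtain ⟨s1, hs1⟩ := H.1 w x
  obtain ⟨s2, hs2⟩ := H.1 w z
  obtain ⟨f, h0, h1, hf, hsf⟩ := seg_param hs
  set L := dist x z with hL
  have hL0 : 0 ≤ L := dist_nonneg
  set A : Set ℝ := {t | t ∈ Icc 0 L ∧ ∃ q ∈ s1, dist (f t) q ≤ δ} with hA
  have hA0 : (0 : ℝ) ∈ A := ⟨⟨le_rfl, hL0⟩, x, seg_right hs1, by rw [h0]; simpa using hδ⟩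
  have hbdd : BddAbove A := ⟨L, fun t ht => ht.1.2⟩
  obtain ⟨t, htA, htlt⟩ := exists_lt_of_lt_csSup ⟨0, hA0⟩ (show sSup A - 1/2 < sSup A by linarith)
  have hcl : ∃ t' ∈ Icc 0 L, |t - t'| ≤ 1 ∧ ∃ q ∈ s2, dist (f t') q ≤ δ := by
    by_cases hc : t + 1 ≤ L
    · have ht' : t + 1 ∈ Icc 0 L := ⟨by linarith [htA.1.1], hc⟩
      refine ⟨t + 1, ht', by norm_num, ?_⟩
      obtain ⟨q, hq, hd⟩ := H.2 x z w s s2 s1 hs (seg_symm hs2) (seg_symm hs1) (f (t + 1))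
        (hsf ▸ ⟨_, ht', rfl⟩)
      rcases hq with hq | hq
      · exact ⟨q, hq, hd⟩
      · have : t + 1 ≤ sSup A := le_csSup hbdd ⟨ht', q, hq, hd⟩
        linarith
    · refine ⟨L, ⟨hL0, le_rfl⟩, ?_, z, seg_right hs2, by rw [h1]; simpa using hδ⟩
      rw [abs_sub_comm, abs_of_nonneg] <;> linarith [htA.1.2]
  obtain ⟨t', ht', htt, q', hq', hd'⟩ := hcl
  obtain ⟨htI, q, hq, hd⟩ := htA
  refine ⟨f t, hsf ▸ ⟨t, htI, rfl⟩, ?_⟩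
  have e1 := seg_add hs1 hq
  have e2 := seg_add hs2 hq'
  have e3 := seg_add hs (p := f t) (hsf ▸ ⟨t, htI, rfl⟩)
  have e4 : dist (f t) (f t') ≤ 1 := by rw [hf t htI t' ht']; exact htt
  have e5 : dist (f t) q' ≤ δ + 1 := by linarith [dist_triangle (f t) (f t') q']
  have a1 := dist_triangle w q (f t)
  have a2 := dist_triangle w q' (f t)
  have a3 := dist_triangle x q (f t)
  have a4 := dist_triangle (f t) q' z
  unfold gromov
  rw [dist_comm q (f t)] at a1 a3
  rw [dist_comm q' (f t)] at a2
  rw [dist_comm x q] at a3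
  rw [dist_comm x w, dist_comm z w]
  linarith

theorem four_point {δ : ℝ} (H : DeltaHyperbolic δ X) (hδ : 0 ≤ δ) (w x y z : X) :
    gromov w x y ≤ gromov w x z + (3 * δ + 1) ∨ gromov w y z ≤ gromov w x z + (3 * δ + 1) := by
  obtain ⟨s, hs⟩ := H.1 x z
  obtain ⟨s1, hs1⟩ := H.1 x y
  obtain ⟨s2, hs2⟩ := H.1 y z
  obtain ⟨p, hp, hd⟩ := near_gromov H hδ (w := w) hs
  obtain ⟨q, hq, hpq⟩ := H.2 x z y s s2 s1 hs (seg_symm hs2) hs1 p hp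
  have := dist_triangle w p q
  rcases hq with hq | hq
  · right; linarith [gromov_le_seg (x := w) hs2 hq]
  · left; linarith [gromov_le_seg (x := w) hs1 hq]

/-- shift along asymptotic rays -/
theorem asymp_shift {δ : ℝ} (H : DeltaHyperbolic δ X) (hδ : 0 ≤ δ) {α β : ℝ → X}
    (hα : IsGeodesicRay α) (hβ : IsGeodesicRay β) (h : Asymptotic α β) :
    ∃ b T : ℝ, ∀ t, T ≤ t → 0 ≤ t + b ∧ dist (α t) (β (t + b)) ≤ 6 * δ := by
  obtain ⟨K, hK, -⟩ := h
  have hK0 : 0 ≤ K := by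
    obtain ⟨b, hb, hd⟩ := hK (α 0) ⟨0, self_mem_Ici, rfl⟩
    exact dist_nonneg.trans hd
  set d := dist (α 0) (β 0) with hd
  have hd0 : 0 ≤ d := dist_nonneg
  have near : ∀ t, d + 2 * δ < t → ∃ s, 0 ≤ s ∧ dist (α t) (β s) ≤ 2 * δ := by
    intro t ht
    have ht0 : 0 ≤ t := by linarith
    set T := t + K + 2 * δ + 1 with hT
    have hT0 : 0 ≤ T := by positivity
    obtain ⟨_, ⟨T', hT', rfl⟩, hd⟩ := hK (α T) ⟨T, hT0, rfl⟩
    rcases quad H (p := α t) (ray_seg hα le_rfl hT0) (ray_seg hβ le_rfl hT')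
      ⟨t, ⟨ht0, by linarith⟩, rfl⟩ hδ with ⟨q, ⟨r, hr, rfl⟩, h⟩ | h | h
    · exact ⟨r, hr.1, h⟩
    · rw [dist_comm, ray_dist0 hα ht0] at h; linarith
    · rw [ray_dist hα ht0 (by linarith)] at h; linarith
  set t0 := d + 2 * δ + 1 with ht0
  obtain ⟨s0, hs0, hn0⟩ := near t0 (by linarith)
  refine ⟨s0 - t0, t0 + s0 + 4 * δ + 1, fun t ht => ⟨by linarith, ?_⟩⟩
  obtain ⟨s, hs, hn⟩ := near t (by linarith)
  have e1 := ray_dist hα (s := t0) (t := t) (by linarith) (by linarith)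
  have e2 := hβ s0 s hs0 hs
  have a1 := dist_triangle4 (α t0) (β s0) (β s) (α t)
  have a2 := dist_triangle4 (β s0) (α t0) (α t) (β s)
  rw [dist_comm (β s)] at a1
  rw [dist_comm (β s0) (α t0)] at a2
  have hlt : s0 ≤ s := by
    by_contra hc
    rw [abs_of_nonneg (by linarith)] at e2
    linarith
  rw [abs_sub_comm, abs_of_nonneg (by linarith)] at e2
  have e3 := hβ s (t + (s0 - t0)) hs (by linarith)
  have : |s - (t + (s0 - t0))| ≤ 4 * δ := by rw [abs_le]; constructor <;> linarith
  linarith [dist_triangle (α t) (β s) (β (t + (s0 - t0)))]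

end Hyp

section Disc
variable {X : Type*} [MetricSpace X]

def DG (τ : ℤ → X) (a b : ℤ) : Prop :=
  ∀ i j : ℤ, a ≤ i → i ≤ b → a ≤ j → j ≤ b → dist (τ i) (τ j) = |(i : ℝ) - j|

theorem exists_edge (H : GeodesicSpace X) (x y : X) : ∃ f : ℝ → X, f 0 = x ∧
    (dist x y = 1 → f 1 = y ∧ ∀ u ∈ Icc (0:ℝ) 1, ∀ v ∈ Icc (0:ℝ) 1, dist (f u) (f v) = |u - v|) := by
  obtain ⟨s, hs⟩ := H x y
  obtain ⟨f, h0, h1, hf, -⟩ := seg_param hs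
  refine ⟨f, h0, fun h => ?_⟩
  rw [h] at h1 hf
  exact ⟨h1, hf⟩

theorem exists_ext (H : GeodesicSpace X) (τ : ℤ → X) : ∃ γ : ℝ → X, (∀ i : ℤ, γ i = τ i) ∧
    ∀ a b : ℤ, DG τ a b → ∀ s t : ℝ, a ≤ s → s ≤ b → a ≤ t → t ≤ b →
      dist (γ s) (γ t) = |s - t| := by
  choose f hf0 hf1 using fun i : ℤ => exists_edge H (τ i) (τ (i + 1))
  have hγ : ∀ i : ℤ, f ⌊(i : ℝ)⌋ (Int.fract (i : ℝ)) = τ i := by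
    intro i; simp [hf0]
  refine ⟨fun t => f ⌊t⌋ (Int.fract t), hγ, ?_⟩
  intro a b hD
  have hedge : ∀ i : ℤ, a ≤ i → i + 1 ≤ b → f i 1 = τ (i + 1) ∧ ∀ u ∈ Icc (0:ℝ) 1,
      ∀ v ∈ Icc (0:ℝ) 1, dist (f i u) (f i v) = |u - v| := by
    intro i ha hb
    apply hf1
    rw [hD i (i + 1) ha (by omega) (by omega) hb]; push_cast; simp
  have hI : ∀ t : ℝ, Int.fract t ∈ Icc (0 : ℝ) 1 :=
    fun t => ⟨Int.fract_nonneg t, (Int.fract_lt_one t).le⟩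
  have hup : ∀ s t : ℝ, a ≤ s → s ≤ t → t ≤ b →
      dist (f ⌊s⌋ (Int.fract s)) (f ⌊t⌋ (Int.fract t)) ≤ t - s := by
    intro s t ha hst hb
    have hfl : ⌊s⌋ ≤ ⌊t⌋ := Int.floor_le_floor hst
    have has : a ≤ ⌊s⌋ := Int.le_floor.2 ha
    have htb : ⌊t⌋ ≤ b := by
      have : (⌊t⌋ : ℝ) ≤ b := (Int.floor_le t).trans hb
      exact_mod_cast this
    have es := Int.floor_add_fract s
    have et := Int.floor_add_fract t
    have h1 : dist (τ ⌊t⌋) (f ⌊t⌋ (Int.fract t)) ≤ Int.fract t := by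
      rcases htb.lt_or_eq with h | h
      · rw [← hf0, (hedge ⌊t⌋ (by omega) (by omega)).2 0 (by simp) _ (hI t)]
        simp [abs_of_nonneg (hI t).1]
      · have : Int.fract t = 0 := by
          have : (⌊t⌋ : ℝ) = b := by exact_mod_cast h
          linarith [Int.fract_nonneg t]
        rw [this, hf0]; simp
    rcases hfl.lt_or_eq with h | h
    · have h2 : dist (f ⌊s⌋ (Int.fract s)) (τ (⌊s⌋ + 1)) ≤ 1 - Int.fract s := by
        obtain ⟨e1, e2⟩ := hedge ⌊s⌋ has (by omega)
        rw [← e1, e2 _ (hI s) 1 (by simp), abs_sub_comm, abs_of_nonneg]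
        linarith [(hI s).2]
      have h3 := hD (⌊s⌋ + 1) ⌊t⌋ (by omega) (by omega) (by omega) htb
      rw [abs_sub_comm, abs_of_nonneg (by
        rw [sub_nonneg]; exact_mod_cast h)] at h3
      push_cast at h3
      linarith [dist_triangle4 (f ⌊s⌋ (Int.fract s)) (τ (⌊s⌋ + 1)) (τ ⌊t⌋) (f ⌊t⌋ (Int.fract t))]
    · rw [h] at es ⊢
      rcases htb.lt_or_eq with h' | h'
      · rw [(hedge ⌊t⌋ (by omega) (by omega)).2 _ (hI s) _ (hI t), abs_sub_comm, abs_of_nonneg]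
          <;> linarith
      · have h6 : (⌊t⌋ : ℝ) = b := by exact_mod_cast h'
        have : Int.fract t = 0 := by
          linarith [Int.fract_nonneg t]
        have h5 : Int.fract s = 0 := by
          linarith [Int.fract_nonneg s]
        rw [this, h5]; simp; exact hst
  have hiso : ∀ s t : ℝ, a ≤ s → s ≤ t → t ≤ b →
      dist (f ⌊s⌋ (Int.fract s)) (f ⌊t⌋ (Int.fract t)) = t - s := by
    intro s t ha hst hb
    apply le_antisymm (hup s t ha hst hb)
    have hab : (a : ℝ) ≤ b := by linarith
    have habz : a ≤ b := by exact_mod_cast hab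
    have h1 := hup a s le_rfl ha (by linarith)
    have h2 := hup t b (by linarith) hb le_rfl
    rw [hγ] at h1 h2
    have h3 := hD a b le_rfl habz habz le_rfl
    rw [abs_sub_comm, abs_of_nonneg (by linarith)] at h3
    linarith [dist_triangle4 (τ a) (f ⌊s⌋ (Int.fract s)) (f ⌊t⌋ (Int.fract t)) (τ b)]
  intro s t h1 h2 h3 h4
  rcases le_total s t with h | h
  · rw [hiso s t h1 h h4, abs_sub_comm, abs_of_nonneg]; linarith
  · rw [dist_comm, hiso t s h3 h h2, abs_of_nonneg]; linarith

end Disc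

section Cayley
variable {G X : Type*} [Group G] [MetricSpace X] [MulAction G X] {S : Finset G} {ι : G → X}

theorem wl_spec (hgen : Subgroup.closure (S : Set G) = ⊤) (g : G) :
    ∃ l : List G, (∀ x ∈ l, x ∈ (S : Set G) ∨ x⁻¹ ∈ (S : Set G)) ∧ l.prod = g ∧
      l.length = wordLength (S : Set G) g := by
  have hne : {n : ℕ | ∃ f : Fin n → G, (∀ i, f i ∈ (S : Set G) ∨ (f i)⁻¹ ∈ (S : Set G)) ∧
      (List.ofFn f).prod = g}.Nonempty := by
    obtain ⟨l, hl, hp⟩ := Submonoid.exists_list_of_mem_closure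
      (s := (S : Set G) ∪ (S : Set G)⁻¹) (x := g)
      (by rw [← Subgroup.closure_toSubmonoid, hgen]; trivial)
    exact ⟨l.length, l.get, fun i => hl _ (List.get_mem l i), by rw [List.ofFn_get, hp]⟩
  obtain ⟨f, hf, hp⟩ := Nat.sInf_mem hne
  refine ⟨List.ofFn f, ?_, hp, by rw [List.length_ofFn]; rfl⟩
  intro x hx
  rw [List.mem_ofFn] at hx
  obtain ⟨i, rfl⟩ := hx
  exact hf i

theorem wl_le {l : List G} (hl : ∀ x ∈ l, x ∈ (S : Set G) ∨ x⁻¹ ∈ (S : Set G)) :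
    wordLength (S : Set G) l.prod ≤ l.length :=
  Nat.sInf_le ⟨l.get, fun i => hl _ (List.get_mem l i), by rw [List.ofFn_get]⟩

theorem exists_vertex (hC : IsCayleyGraph G (S : Set G) X ι) (x : X) :
    ∃ g, dist x (ι g) ≤ 1 := by
  obtain ⟨-, -, -, -, hd, hx⟩ := hC
  obtain ⟨g, h, hl, s, hs, hxs⟩ := hx x
  refine ⟨g, ?_⟩
  have := seg_add hs hxs
  rw [hd] at this
  have h1 : (wordLength (S : Set G) (g⁻¹ * h) : ℝ) ≤ 1 := by exact_mod_cast hl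
  rw [dist_comm]
  linarith [dist_nonneg (x := x) (y := ι h)]

theorem exists_disc (hC : IsCayleyGraph G (S : Set G) X ι)
    (hgen : Subgroup.closure (S : Set G) = ⊤) (g h : G) :
    ∃ (σ : ℤ → G) (L : ℕ), (L : ℝ) = dist (ι g) (ι h) ∧ σ 0 = g ∧ σ L = h ∧
      DG (fun i => ι (σ i)) 0 L := by
  obtain ⟨-, -, -, -, hd, -⟩ := hC
  obtain ⟨l, hl, hp, hlen⟩ := wl_spec hgen (g⁻¹ * h)
  have hL : (l.length : ℝ) = dist (ι g) (ι h) := by rw [hd, hlen]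
  set σ : ℤ → G := fun i => g * (l.take i.toNat).prod with hσ
  have e0 : σ 0 = g := by simp [hσ]
  have eL : σ l.length = h := by simp [hσ, hp]
  have hup : ∀ i j : ℤ, 0 ≤ i → i ≤ j → dist (ι (σ i)) (ι (σ j)) ≤ j - i := by
    intro i j hi hij
    have e : (σ i)⁻¹ * σ j = ((l.take j.toNat).drop i.toNat).prod := by
      have : (l.take j.toNat) = l.take i.toNat ++ (l.take j.toNat).drop i.toNat := by
        conv_lhs => rw [← List.take_append_drop i.toNat (l.take j.toNat)]
        rw [List.take_take, min_eq_left (by omega)]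
      simp only [hσ]
      rw [mul_inv_rev, mul_assoc, inv_mul_cancel_left]
      conv_lhs => rw [this, List.prod_append]
      rw [inv_mul_cancel_left]
    rw [hd, e]
    have h1 := wl_le (S := S) (l := (l.take j.toNat).drop i.toNat)
      (fun x hx => hl x (List.mem_of_mem_take (List.mem_of_mem_drop hx)))
    have h2 : ((l.take j.toNat).drop i.toNat).length ≤ j.toNat - i.toNat := by
      rw [List.length_drop, List.length_take]; omega
    have h3 : ((wordLength (S : Set G) ((l.take j.toNat).drop i.toNat).prod : ℕ) : ℤ) ≤ j - i := by
      omega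
    exact_mod_cast h3
  refine ⟨σ, l.length, hL, e0, eL, ?_⟩
  have hiso : ∀ i j : ℤ, 0 ≤ i → i ≤ j → j ≤ l.length → dist (ι (σ i)) (ι (σ j)) = j - i := by
    intro i j hi hij hj
    apply le_antisymm (hup i j hi hij)
    have h1 := hup 0 i le_rfl hi
    have h2 := hup j l.length (by omega) hj
    rw [e0] at h1
    rw [eL] at h2
    push_cast at h1 h2
    linarith [dist_triangle4 (ι g) (ι (σ i)) (ι (σ j)) (ι h)]
  intro i j h1 h2 h3 h4
  show dist (ι (σ i)) (ι (σ j)) = _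
  rcases le_total i j with h | h
  · rw [hiso i j h1 h h4, abs_sub_comm, abs_of_nonneg]
    rw [sub_nonneg]; exact_mod_cast h
  · rw [dist_comm, hiso j i h3 h h2, abs_of_nonneg]
    rw [sub_nonneg]; exact_mod_cast h

theorem ball_card (hC : IsCayleyGraph G (S : Set G) X ι)
    (hgen : Subgroup.closure (S : Set G) = ⊤) (k : ℕ) :
    ∃ B : Finset G, B.card ≤ (2 * S.card + 1) ^ k ∧ ∀ g h : G, dist (ι g) (ι h) ≤ k →
      g⁻¹ * h ∈ B := by
  classical
  obtain ⟨-, -, -, -, hd, -⟩ := hC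
  set T : Finset G := insert 1 (S ∪ S⁻¹) with hT
  have hTc : T.card ≤ 2 * S.card + 1 := by
    refine (Finset.card_insert_le _ _).trans ?_
    have := Finset.card_union_le S S⁻¹
    rw [Finset.card_inv] at this
    omega
  refine ⟨T ^ k, (Finset.card_pow_le).trans (Nat.pow_le_pow_left hTc k), ?_⟩
  intro g h hgh
  rw [hd] at hgh
  have hgh : wordLength (S : Set G) (g⁻¹ * h) ≤ k := by exact_mod_cast hgh
  obtain ⟨l, hl, hp, hlen⟩ := wl_spec hgen (g⁻¹ * h)
  rw [← hp]
  rw [← hlen] at hgh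
  have h1T : (1 : G) ∈ T := Finset.mem_insert_self _ _
  have key : ∀ l : List G, (∀ x ∈ l, x ∈ (S : Set G) ∨ x⁻¹ ∈ (S : Set G)) →
      l.prod ∈ T ^ l.length := by
    intro l
    induction l with
    | nil => intro _; simp
    | cons a l ih =>
      intro hl
      rw [List.prod_cons, List.length_cons, pow_succ']
      refine Finset.mul_mem_mul ?_ (ih fun x hx => hl x (List.mem_cons_of_mem _ hx))
      rcases hl a List.mem_cons_self with h | h
      · simp only [hT, Finset.mem_insert, Finset.mem_union]
        exact Or.inr (Or.inl (by exact_mod_cast h))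
      · simp only [hT, Finset.mem_insert, Finset.mem_union, Finset.mem_inv']
        exact Or.inr (Or.inr (by exact_mod_cast h))
  exact Finset.pow_subset_pow_right h1T hgh (key l hl)

theorem ball_finite (hC : IsCayleyGraph G (S : Set G) X ι)
    (hgen : Subgroup.closure (S : Set G) = ⊤) (x : X) (R : ℝ) :
    {g : G | dist x (ι g) ≤ R}.Finite := by
  obtain ⟨h, hh⟩ := exists_vertex hC x
  obtain ⟨B, -, hB⟩ := ball_card hC hgen ⌈R + 1⌉₊
  refine ((B.finite_toSet).image (fun b => h * b)).subset ?_
  intro g hg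
  refine ⟨h⁻¹ * g, hB h g ?_, by simp⟩
  refine le_trans ?_ (Nat.le_ceil _)
  have : dist x (ι g) ≤ R := hg
  rw [dist_comm] at hh
  linarith [dist_triangle (ι h) x (ι g)]

theorem disp_card (hC : IsCayleyGraph G (S : Set G) X ι)
    (hgen : Subgroup.closure (S : Set G) = ⊤) (z : X) (R : ℝ) (k : ℕ) (hk : R + 2 ≤ k)
    (F : Finset G) (hF : ∀ g ∈ F, dist z (g • z) ≤ R) : F.card ≤ (2 * S.card + 1) ^ k := by
  classical
  obtain ⟨h, hh⟩ := exists_vertex hC z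
  obtain ⟨B, hBc, hB⟩ := ball_card hC hgen k
  refine le_trans ?_ hBc
  refine Finset.card_le_card_of_injOn (fun g => h⁻¹ * (g * h)) ?_ ?_
  · intro g hg
    refine hB h (g * h) ?_
    rw [hC.2.1]
    have h1 := hC.1 g z (ι h)
    have h2 := dist_triangle4 (ι h) z (g • z) (g • ι h)
    rw [dist_comm (ι h) z] at h2
    linarith [hF g hg]
  · intro a _ b _ hab
    simpa using hab

/-- ultralimits of sequences of vertices -/
theorem ultralimit (hC : IsCayleyGraph G (S : Set G) X ι)
    (hgen : Subgroup.closure (S : Set G) = ⊤) (σ : ℕ → ℤ → G) (I : Set ℤ) (x : X)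
    (h : ∀ i ∈ I, ∃ R : ℝ, ∀ᶠ n in Filter.atTop, dist x (ι (σ n i)) ≤ R) :
    ∃ τ : ℤ → G, ∀ i ∈ I, ∀ᶠ n in (Filter.hyperfilter ℕ : Filter ℕ), σ n i = τ i := by
  have : ∀ i, ∃ g : G, i ∈ I → ∀ᶠ n in (Filter.hyperfilter ℕ : Filter ℕ), σ n i = g := by
    intro i
    by_cases hi : i ∈ I
    · obtain ⟨R, hR⟩ := h i hi
      have hR' : ∀ᶠ n in (Filter.hyperfilter ℕ : Filter ℕ),
          σ n i ∈ {g : G | dist x (ι g) ≤ R} := Nat.hyperfilter_le_atTop hR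
      have hfin := ball_finite hC hgen x R
      have : ∀ᶠ n in (Filter.hyperfilter ℕ : Filter ℕ),
          ∃ g ∈ {g : G | dist x (ι g) ≤ R}, σ n i = g := by
        filter_upwards [hR'] with n hn
        exact ⟨_, hn, rfl⟩
      rw [Ultrafilter.eventually_exists_mem_iff hfin] at this
      obtain ⟨g, -, hg⟩ := this
      exact ⟨g, fun _ => hg⟩
    · exact ⟨1, fun h => absurd h hi⟩
  choose τ hτ using this
  exact ⟨τ, hτ⟩

end Cayley

section Lim
variable {G X : Type*} [Group G] [MetricSpace X] [MulAction G X] {S : Finset G} {ι : G → X}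

theorem exists_limit_ray (hC : IsCayleyGraph G (S : Set G) X ι)
    (hgen : Subgroup.closure (S : Set G) = ⊤) (u : ℕ → G)
    (hu : ∀ R : ℝ, ∀ᶠ n in Filter.atTop, R ≤ dist (ι 1) (ι (u n))) :
    ∃ γ : ℝ → X, IsGeodesicRay γ ∧ γ 0 = ι 1 ∧ ∃ φ : ℕ → ℕ, ∀ k : ℕ,
      dist (ι 1) (ι (u (φ k))) = k + dist (γ k) (ι (u (φ k))) := by
  choose σ L hL h0 h1 hD using fun n => exists_disc hC hgen 1 (u n)
  have hev : ∀ k : ℕ, ∀ᶠ n in Filter.atTop, k ≤ L n := by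
    intro k
    filter_upwards [hu k] with n hn
    rw [← hL] at hn
    exact_mod_cast hn
  obtain ⟨τ, hτ⟩ := ultralimit hC hgen σ {i | 0 ≤ i} (ι 1) (by
    intro i hi
    refine ⟨i, ?_⟩
    filter_upwards [hev i.toNat] with n hn
    have hi' : 0 ≤ i := hi
    have := hD n 0 i le_rfl (by omega) hi' (by omega)
    simp only [h0] at this
    rw [this]
    have : (0 : ℝ) ≤ i := by exact_mod_cast hi'
    simp [abs_of_nonneg this])
  have hK : ∀ K : ℕ, ∃ n, (∀ i : ℤ, 0 ≤ i → i ≤ K → σ n i = τ i) ∧ K ≤ L n := by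
    intro K
    have e1 : ∀ᶠ n in (Filter.hyperfilter ℕ : Filter ℕ),
        ∀ i ∈ Finset.Icc (0 : ℤ) K, σ n i = τ i :=
      (Filter.eventually_all_finset _).2 fun i hi => hτ i (Finset.mem_Icc.1 hi).1
    have e2 := Nat.hyperfilter_le_atTop (hev K)
    obtain ⟨n, hn1, hn2⟩ := (e1.and e2).exists
    exact ⟨n, fun i h h' => hn1 i (Finset.mem_Icc.2 ⟨h, h'⟩), hn2⟩
  have hDG : ∀ K : ℕ, DG (fun i => ι (τ i)) 0 K := by
    intro K i j hi hi' hj hj'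
    obtain ⟨n, hn, hKL⟩ := hK K
    have := hD n i j hi (by omega) hj (by omega)
    simp only [hn i hi hi', hn j hj hj'] at this
    exact this
  obtain ⟨γ, hγ, hγd⟩ := exists_ext hC.2.2.2.1 (fun i => ι (τ i))
  have hτ0 : τ 0 = 1 := by
    obtain ⟨n, hn, -⟩ := hK 0
    rw [← hn 0 le_rfl le_rfl, h0]
  choose φ hφ hφL using hK
  refine ⟨γ, ?_, ?_, φ, ?_⟩
  · intro s t hs ht
    refine hγd 0 _ (hDG (⌈s⌉₊ + ⌈t⌉₊)) s t (by simpa using hs) ?_ (by simpa using ht) ?_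
    · push_cast; linarith [Nat.le_ceil s, Nat.le_ceil t, (Nat.cast_nonneg ⌈t⌉₊ : (0:ℝ) ≤ _)]
    · push_cast; linarith [Nat.le_ceil s, Nat.le_ceil t, (Nat.cast_nonneg ⌈s⌉₊ : (0:ℝ) ≤ _)]
  · have := hγ 0
    simpa [hτ0] using this
  · intro k
    have e1 := hγ k
    simp only [Int.cast_natCast] at e1
    rw [e1, ← hφ k k (by omega) le_rfl]
    have e2 := hD (φ k) k (L (φ k)) (by omega) (by exact_mod_cast hφL k) (by omega) le_rfl
    simp only [h1] at e2
    rw [e2, ← hL, abs_sub_comm, abs_of_nonneg]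
    · push_cast; ring
    · rw [sub_nonneg]; exact_mod_cast hφL k

theorem gromov_of_between {x y z : X} {k : ℝ} (h : dist x z = k + dist y z)
    (hy : dist x y = k) : gromov x z y = k := by
  unfold gromov
  rw [dist_comm z x, dist_comm y x, h, hy, dist_comm z y]; ring

theorem ray_mem_limitSet (hC : IsCayleyGraph G (S : Set G) X ι) {U : Subgroup G} {u : ℕ → G}
    (hu : ∀ n, u n ∈ U) {γ : ℝ → X} (hγ : IsGeodesicRay γ) (h0 : γ 0 = ι 1) {φ : ℕ → ℕ}
    (hφ : ∀ k : ℕ, dist (ι 1) (ι (u (φ k))) = k + dist (γ k) (ι (u (φ k)))) :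
    Boundary.mk ⟨γ, hγ⟩ ∈ limitSet X U := by
  refine ⟨ι 1, fun k => ⟨u (φ k), hu _⟩, ⟨γ, hγ⟩, rfl, ?_⟩
  intro M
  refine ⟨⌈M⌉₊, fun n hn m hm => ?_⟩
  show M ≤ gromov (ι 1) (u (φ n) • ι 1) (γ m)
  rw [← hC.2.1, mul_one]
  have hMn : M ≤ n := (Nat.le_ceil M).trans (by exact_mod_cast hn)
  have hMm : M ≤ m := (Nat.le_ceil M).trans (by exact_mod_cast hm)
  have e1 := ray_dist0 hγ (t := n) (by positivity)
  have e2 := ray_dist0 hγ (t := m) (by positivity)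
  rw [h0] at e1 e2
  have e3 := hφ n
  unfold gromov
  rw [dist_comm _ (ι 1), dist_comm _ (ι 1), e2, e3]
  have e5 := hγ n m (by positivity) (by positivity)
  have e6 := dist_triangle (ι (u (φ n))) (γ n) (γ m)
  rw [dist_comm _ (γ n)] at e6
  have e7 := abs_cases ((n : ℝ) - m)
  rcases e7 with h | h <;> linarith

theorem exists_bigeodesic {δ : ℝ} (H : DeltaHyperbolic δ X) (hδ : 0 ≤ δ)
    (hC : IsCayleyGraph G (S : Set G) X ι)
    (hgen : Subgroup.closure (S : Set G) = ⊤) {α β : ℝ → X} (hα : IsGeodesicRay α)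
    (hβ : IsGeodesicRay β) (h : ¬ Asymptotic α β) :
    ∃ γ : ℝ → X, IsBiGeodesic γ ∧ Asymptotic (fun t => γ (-t)) α ∧ Asymptotic γ β := by
  obtain ⟨t0, ht0, hq⟩ := not_asymp_point H hδ hα hβ h
  choose a ha using fun n : ℕ => exists_vertex hC (α n)
  choose b hb using fun n : ℕ => exists_vertex hC (β n)
  choose σ L hL h0 h1 hD using fun n => exists_disc hC hgen (a n) (b n)
  set C := 4 * δ + 2 with hCdef
  -- a vertex near `α t0`
  have hj : ∀ n : ℕ, ∃ j : ℤ, t0 ≤ n → 0 ≤ j ∧ j ≤ L n ∧ dist (α t0) (ι (σ n j)) ≤ C := by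
    intro n
    by_cases hn : t0 ≤ n
    · obtain ⟨s, hs⟩ := H.1 (α n) (β n)
      obtain ⟨q, hqs, hqd⟩ := hq n n hn (by positivity) s hs
      obtain ⟨γ, hγ, hγd⟩ := exists_ext H.1 (fun i => ι (σ n i))
      have hs' : IsGeodesicSegment (γ '' Icc 0 (L n : ℝ)) (γ 0) (γ (L n : ℝ)) :=
        seg_of_iso (by positivity) fun u hu v hv =>
          hγd 0 (L n) (hD n) u v (by simpa using hu.1) (by simpa using hu.2)
            (by simpa using hv.1) (by simpa using hv.2)
      have e0 : γ 0 = ι (a n) := by have := hγ 0; simpa [h0] using this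
      have e1 : γ (L n : ℝ) = ι (b n) := by have := hγ (L n); simpa [h1] using this
      rw [e0, e1] at hs'
      obtain ⟨q', ⟨r, hr, rfl⟩, hd⟩ := quad_max H hs hs' hqs hδ (ha n) (hb n)
      refine ⟨⌊r⌋, fun _ => ⟨Int.floor_nonneg.2 hr.1, ?_, ?_⟩⟩
      · have : (⌊r⌋ : ℝ) ≤ (L n : ℤ) := (Int.floor_le r).trans (by simpa using hr.2)
        exact_mod_cast this
      · have hfl := Int.floor_le r
        have hfl' := Int.lt_floor_add_one r
        have hf0 : (0 : ℝ) ≤ ⌊r⌋ := by exact_mod_cast Int.floor_nonneg.2 hr.1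
        have e2 := hγd 0 (L n) (hD n) r ⌊r⌋ (by simpa using hr.1) (by simpa using hr.2)
          (by simpa using hf0) (by push_cast; linarith [hr.2])
        rw [hγ, abs_of_nonneg (by linarith)] at e2
        linarith [dist_triangle4 (α t0) q (γ r) (ι (σ n ⌊r⌋))]
    · exact ⟨0, fun h => absurd h hn⟩
  choose j hj using hj
  have hC0 : 0 ≤ C := by positivity
  have hevt : ∀ M : ℕ, ∀ᶠ n : ℕ in Filter.atTop, t0 ≤ n ∧ (M : ℤ) ≤ j n ∧ (M : ℤ) ≤ L n - j n := by
    intro M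
    filter_upwards [Filter.eventually_ge_atTop ⌈t0 + C + 1 + M + dist (α t0) (β 0)⌉₊] with n hn
    have hn' : t0 + C + 1 + M + dist (α t0) (β 0) ≤ n :=
      (Nat.le_ceil _).trans (by exact_mod_cast hn)
    have hM : (0 : ℝ) ≤ M := by positivity
    have hd := dist_nonneg (x := α t0) (y := β 0)
    have htn : t0 ≤ n := by linarith
    obtain ⟨j0, jL, jd⟩ := hj n htn
    refine ⟨htn, ?_, ?_⟩
    · have e1 := hD n 0 (j n) le_rfl (by omega) j0 jL
      simp only [h0] at e1
      have j0' : (0 : ℝ) ≤ j n := by exact_mod_cast j0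
      rw [abs_sub_comm, abs_of_nonneg (by simpa using j0')] at e1
      push_cast at e1
      have e2 := ray_dist hα ht0 htn
      have e3 := dist_triangle4 (α t0) (ι (σ n (j n))) (ι (a n)) (α n)
      rw [dist_comm (ι (σ n (j n))), dist_comm (ι (a n)) (α n), e1] at e3
      have : (M : ℝ) ≤ j n := by linarith [ha n]
      exact_mod_cast this
    · have e1 := hD n (j n) (L n) j0 jL (by omega) le_rfl
      simp only [h1] at e1
      have jL' : (j n : ℝ) ≤ (L n : ℤ) := by exact_mod_cast jL
      rw [abs_sub_comm, abs_of_nonneg (by linarith)] at e1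
      have e2 := ray_dist0 hβ (t := n) (by positivity)
      have e3 := dist_triangle4 (α t0) (ι (σ n (j n))) (ι (b n)) (β n)
      rw [dist_comm (ι (b n)) (β n), e1] at e3
      have e4 := dist_triangle (β 0) (α t0) (β n)
      rw [dist_comm (β 0) (α t0)] at e4
      have : (M : ℝ) ≤ (L n : ℤ) - j n := by linarith [hb n]
      exact_mod_cast this
  obtain ⟨τ, hτ⟩ := ultralimit hC hgen (fun n i => σ n (i + j n)) univ (α t0) (by
    intro i _
    refine ⟨C + |(i : ℝ)|, ?_⟩
    filter_upwards [hevt i.natAbs] with n ⟨htn, hn1, hn2⟩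
    obtain ⟨j0, jL, jd⟩ := hj n htn
    have e1 := hD n (j n) (i + j n) j0 jL (by omega) (by omega)
    have e2 : |(j n : ℝ) - ((i + j n : ℤ) : ℝ)| = |(i : ℝ)| := by
      rw [abs_sub_comm]; push_cast; congr 1; ring
    rw [e2] at e1
    have := dist_triangle (α t0) (ι (σ n (j n))) (ι (σ n (i + j n)))
    simp only at e1
    linarith)
  have hK : ∀ K : ℕ, ∃ n : ℕ, (∀ i : ℤ, -K ≤ i → i ≤ K → σ n (i + j n) = τ i) ∧
      t0 ≤ n ∧ (K : ℤ) ≤ j n ∧ (K : ℤ) ≤ L n - j n := by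
    intro K
    have e1 : ∀ᶠ n in (Filter.hyperfilter ℕ : Filter ℕ),
        ∀ i ∈ Finset.Icc (-K : ℤ) K, σ n (i + j n) = τ i :=
      (Filter.eventually_all_finset _).2 fun i hi => hτ i (mem_univ _)
    have e2 := Nat.hyperfilter_le_atTop (hevt K)
    obtain ⟨n, hn1, hn2⟩ := (e1.and e2).exists
    exact ⟨n, fun i h h' => hn1 i (Finset.mem_Icc.2 ⟨h, h'⟩), hn2⟩
  have hDG : ∀ K : ℕ, DG (fun i => ι (τ i)) (-K) K := by
    intro K i i' hi hi2 hj' hj2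
    obtain ⟨n, hn, htn, hK1, hK2⟩ := hK K
    have := hD n (i + j n) (i' + j n) (by omega) (by omega) (by omega) (by omega)
    simp only [hn i hi hi2, hn i' hj' hj2] at this
    show dist (ι (τ i)) (ι (τ i')) = _
    rw [this]; push_cast; congr 1; ring
  obtain ⟨γ, hγ, hγd⟩ := exists_ext H.1 (fun i => ι (τ i))
  have hbi : IsBiGeodesic γ := by
    intro s t
    have h1 := Nat.le_ceil |s|
    have h2 := Nat.le_ceil |t|
    have h3 : (0:ℝ) ≤ ⌈|s|⌉₊ := by positivity
    have h4 : (0:ℝ) ≤ ⌈|t|⌉₊ := by positivity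
    have h5 := neg_abs_le s
    have h6 := neg_abs_le t
    have h7 := le_abs_self s
    have h8 := le_abs_self t
    refine hγd _ _ (hDG (⌈|s|⌉₊ + ⌈|t|⌉₊)) s t ?_ ?_ ?_ ?_ <;> push_cast <;> linarith
  have hr1 : IsGeodesicRay (fun t => γ (-t)) := by
    intro s t _ _
    rw [hbi, abs_sub_comm]; congr 1; ring
  have hr2 : IsGeodesicRay γ := fun s t _ _ => hbi s t
  -- vertices of the path are close to the rays
  have near1 : ∀ i : ℕ, ∃ s, 0 ≤ s ∧ dist (ι (τ (-i))) (α s) ≤ 2 * δ + C := by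
    intro i
    obtain ⟨n, hn, htn, hK1, hK2⟩ := hK i
    obtain ⟨j0, jL, jd⟩ := hj n htn
    obtain ⟨η, hη, hηd⟩ := exists_ext H.1 (fun i => ι (σ n i))
    have j0' : (0 : ℝ) ≤ j n := by exact_mod_cast j0
    have jL' : (j n : ℝ) ≤ (L n : ℤ) := by exact_mod_cast jL
    have hs : IsGeodesicSegment (η '' Icc 0 (j n : ℝ)) (η 0) (η (j n)) :=
      seg_of_iso j0' fun u hu v hv =>
        hηd 0 (L n) (hD n) u v (by simpa using hu.1) (hu.2.trans jL')
          (by simpa using hv.1) (hv.2.trans jL')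
    have e0 : η 0 = ι (a n) := by have := hη 0; simpa [h0] using this
    rw [e0, hη] at hs
    have hmem : ι (τ (-i)) ∈ η '' Icc 0 (j n : ℝ) := by
      refine ⟨((-i + j n : ℤ) : ℝ), ⟨?_, ?_⟩, ?_⟩
      · exact_mod_cast (by omega : (0 : ℤ) ≤ -i + j n)
      · exact_mod_cast (by omega : -i + j n ≤ j n)
      · rw [hη, hn (-i) le_rfl (by omega)]
    obtain ⟨q, ⟨r, hr, rfl⟩, hd⟩ := quad_max H hs (seg_symm (ray_seg hα ht0 htn)) hmem hδ
      (R := C) (by rw [dist_comm]; linarith [ha n]) (by rw [dist_comm]; exact jd)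
    exact ⟨r, ht0.trans hr.1, hd⟩
  have near2 : ∀ i : ℕ, ∃ s, 0 ≤ s ∧
      dist (ι (τ i)) (β s) ≤ 2 * δ + (C + dist (α t0) (β 0)) := by
    intro i
    obtain ⟨n, hn, htn, hK1, hK2⟩ := hK i
    obtain ⟨j0, jL, jd⟩ := hj n htn
    obtain ⟨η, hη, hηd⟩ := exists_ext H.1 (fun i => ι (σ n i))
    have j0' : (0 : ℝ) ≤ j n := by exact_mod_cast j0
    have jL' : (j n : ℝ) ≤ (L n : ℤ) := by exact_mod_cast jL
    have hs : IsGeodesicSegment (η '' Icc (j n : ℝ) (L n : ℤ)) (η (j n)) (η (L n : ℤ)) :=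
      seg_of_iso jL' fun u hu v hv =>
        hηd 0 (L n) (hD n) u v (by simpa using j0'.trans hu.1) hu.2
          (by simpa using j0'.trans hv.1) hv.2
    rw [hη, hη] at hs
    simp only [h1] at hs
    have hmem : ι (τ i) ∈ η '' Icc (j n : ℝ) (L n : ℤ) := by
      refine ⟨((i + j n : ℤ) : ℝ), ⟨?_, ?_⟩, ?_⟩
      · exact_mod_cast (by omega : j n ≤ (i : ℤ) + j n)
      · exact_mod_cast (by omega : (i : ℤ) + j n ≤ L n)
      · rw [hη, hn i (by omega) le_rfl]
    obtain ⟨q, ⟨r, hr, rfl⟩, hd⟩ := quad_max H hs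
      (ray_seg hβ le_rfl (show (0:ℝ) ≤ (n : ℝ) by positivity)) hmem hδ
      (R := C + dist (α t0) (β 0))
      (by
        have := dist_triangle (ι (σ n (j n))) (α t0) (β 0)
        rw [dist_comm _ (α t0)] at this
        linarith) (by
        rw [dist_comm]
        linarith [hb n, dist_nonneg (x := α t0) (y := β 0)])
    exact ⟨r, hr.1, hd⟩
  refine ⟨γ, hbi, asymp_of_near H hδ hr1 hα (K := 1 + (2 * δ + C)) ?_,
    asymp_of_near H hδ hr2 hβ (K := 1 + (2 * δ + (C + dist (α t0) (β 0)))) ?_⟩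
  · intro t ht
    obtain ⟨s, hs, hd⟩ := near1 ⌊t⌋₊
    refine ⟨s, hs, ?_⟩
    have e1 := hγ (-⌊t⌋₊)
    have e2 := hbi (-t) ((-⌊t⌋₊ : ℤ) : ℝ)
    rw [e1] at e2
    push_cast at e2
    have h1 := Nat.floor_le ht
    have h2 := Nat.lt_floor_add_one t
    rw [abs_sub_comm, abs_of_nonneg (by linarith)] at e2
    linarith [dist_triangle (γ (-t)) (ι (τ (-⌊t⌋₊))) (α s)]
  · intro t ht
    obtain ⟨s, hs, hd⟩ := near2 ⌊t⌋₊
    refine ⟨s, hs, ?_⟩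
    have e1 := hγ (⌊t⌋₊)
    have e2 := hbi t ((⌊t⌋₊ : ℤ) : ℝ)
    rw [e1] at e2
    push_cast at e2
    have h1 := Nat.floor_le ht
    have h2 := Nat.lt_floor_add_one t
    rw [abs_of_nonneg (by linarith)] at e2
    linarith [dist_triangle (γ t) (ι (τ (⌊t⌋₊))) (β s)]

/-- finite subgroups almost fix a point -/
theorem finite_subgroup_point {δ : ℝ} (H : DeltaHyperbolic δ X) (hδ : 0 ≤ δ)
    (hiso : IsometricAction G X) (x0 : X) (F : Subgroup G) (hF : (F : Set G).Finite) :
    ∃ z : X, ∀ f ∈ F, dist z (f • z) ≤ 4 * δ + 2 := by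
  classical
  set A := hF.toFinset with hA
  have hmem : ∀ g, g ∈ A ↔ g ∈ F := by intro g; simp [hA]
  have hne : A.Nonempty := ⟨1, (hmem 1).2 F.one_mem⟩
  set r : X → ℝ := fun z => A.sup' hne (fun g => dist z (g • x0)) with hr
  have hle : ∀ z, ∀ g ∈ F, dist z (g • x0) ≤ r z := fun z g hg =>
    Finset.le_sup' (fun g => dist z (g • x0)) ((hmem g).2 hg)
  have hbdd : BddBelow (range r) :=
    ⟨0, by rintro _ ⟨z, rfl⟩; exact dist_nonneg.trans (hle z 1 F.one_mem)⟩
  have : Nonempty X := ⟨x0⟩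
  obtain ⟨z, hz⟩ := exists_lt_of_ciInf_lt (show (⨅ z, r z) < (⨅ z, r z) + 1 by linarith)
  refine ⟨z, fun f hf => ?_⟩
  obtain ⟨s, hs⟩ := H.1 z (f • z)
  obtain ⟨m, hm, hzm⟩ := seg_point hs (t := dist z (f • z) / 2) (by positivity)
    (by linarith [dist_nonneg (x := z) (y := f • z)])
  have hmf := seg_add hs hm
  have key : r m ≤ r z + 2 * δ - dist z (f • z) / 2 := by
    refine Finset.sup'_le hne _ fun g hg => ?_
    have hgF := (hmem g).1 hg
    have b1 := hle z g hgF
    have b2 : dist (f • z) (g • x0) ≤ r z := by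
      have := hle z (f⁻¹ * g) (F.mul_mem (F.inv_mem hf) hgF)
      rw [← hiso f, smul_smul, mul_inv_cancel_left] at this
      exact this
    obtain ⟨s1, hs1⟩ := H.1 (f • z) (g • x0)
    obtain ⟨s2, hs2⟩ := H.1 z (g • x0)
    obtain ⟨q, hq, hd⟩ := H.2 _ _ _ s s1 s2 hs hs1 hs2 m hm
    rcases hq with hq | hq
    · have e1 := seg_add hs1 hq
      have e2 := dist_triangle m q (g • x0)
      have e3 := dist_triangle m q (f • z)
      rw [dist_comm q (f • z)] at e3
      linarith
    · have e1 := seg_add hs2 hq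
      have e2 := dist_triangle m q (g • x0)
      have e3 := dist_triangle z q m
      rw [dist_comm q m] at e3
      linarith
  have : (⨅ z, r z) ≤ r m := ciInf_le hbdd m
  linarith

end Lim

section Lam
variable {G X : Type*} [Group G] [MetricSpace X] [MulAction G X] {S : Finset G} {ι : G → X}

theorem mk_eq_iff (γ γ' : GRay X) : Boundary.mk γ = Boundary.mk γ' ↔ Asymptotic γ.1 γ'.1 :=
  ⟨fun h => Quotient.exact h, fun h => Quotient.sound h⟩

theorem ray_smul (hiso : IsometricAction G X) (g : G) {γ : ℝ → X} (h : IsGeodesicRay γ) :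
    IsGeodesicRay (fun t => g • γ t) := fun s t hs ht => by rw [hiso]; exact h s t hs ht

theorem asymp_smul (hiso : IsometricAction G X) (g : G) {α β : ℝ → X} (h : Asymptotic α β) :
    Asymptotic (fun t => g • α t) (fun t => g • β t) := by
  obtain ⟨K, h1, h2⟩ := h
  refine ⟨K, ?_, ?_⟩
  · rintro _ ⟨t, ht, rfl⟩
    obtain ⟨_, ⟨r, hr, rfl⟩, hd⟩ := h1 _ ⟨t, ht, rfl⟩
    exact ⟨_, ⟨r, hr, rfl⟩, by rwa [hiso]⟩
  · rintro _ ⟨t, ht, rfl⟩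
    obtain ⟨_, ⟨r, hr, rfl⟩, hd⟩ := h2 _ ⟨t, ht, rfl⟩
    exact ⟨_, ⟨r, hr, rfl⟩, by rwa [hiso]⟩

theorem limitSet_smul (hiso : IsometricAction G X) {U : Subgroup G} {u : G} (hu : u ∈ U)
    {γ : ℝ → X} (hγ : IsGeodesicRay γ) (h : Boundary.mk ⟨γ, hγ⟩ ∈ limitSet X U) :
    Boundary.mk ⟨fun t => u • γ t, ray_smul hiso u hγ⟩ ∈ limitSet X U := by
  obtain ⟨x0, v, γ', he, hc⟩ := h
  refine ⟨u • x0, fun n => ⟨u * v n * u⁻¹, U.mul_mem (U.mul_mem hu (v n).2) (U.inv_mem hu)⟩,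
    ⟨fun t => u • γ'.1 t, ray_smul hiso u γ'.2⟩, ?_, ?_⟩
  · exact (mk_eq_iff _ _).2 (asymp_smul hiso u ((mk_eq_iff _ _).1 he))
  · intro M
    obtain ⟨N, hN⟩ := hc M
    refine ⟨N, fun n hn m hm => ?_⟩
    have := hN n hn m hm
    unfold gromov at this ⊢
    simp only [smul_smul, inv_mul_cancel_right]
    simp only [mul_smul]
    rw [hiso, hiso, hiso]
    exact this

theorem gromov_comm (w x y : X) : gromov w x y = gromov w y x := by
  unfold gromov; rw [dist_comm x y]; ring

theorem lox_aux {δ : ℝ} (H : DeltaHyperbolic δ X) (hδ : 0 ≤ δ) (hiso : IsometricAction G X)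
    (f : G) (z : X) (a : ℝ) (ha : 0 ≤ a) (hd : 2 * a + 3 * (3 * δ + 1) + 1 ≤ dist z (f • z))
    (hg : gromov z (f⁻¹ • z) (f • z) ≤ a) (m : ℕ) :
    gromov z ((f⁻¹) ^ m • z) (f • z) ≤ a + (3 * δ + 1) := by
  induction m with
  | zero =>
    have : gromov z ((f⁻¹) ^ 0 • z) (f • z) = 0 := by
      unfold gromov; simp [dist_comm]
    rw [this]; positivity
  | succ m ih =>
    rcases four_point H hδ z (f⁻¹ • z) ((f⁻¹) ^ (m + 1) • z) (f • z) with h | h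
    · exfalso
      have e1 : dist (f⁻¹ • z) z = dist z (f • z) := by
        rw [← hiso f, smul_inv_smul]
      have e2 : dist (f⁻¹ • z) ((f⁻¹) ^ (m + 1) • z) = dist z ((f⁻¹) ^ m • z) := by
        rw [← hiso f, smul_inv_smul, smul_smul, pow_succ', mul_inv_cancel_left]
      have e3 : dist ((f⁻¹) ^ (m + 1) • z) z = dist ((f⁻¹) ^ m • z) (f • z) := by
        rw [← hiso f, smul_smul, pow_succ', mul_inv_cancel_left]
      unfold gromov at h ih hg
      rw [e1, e2, e3] at h
      rw [e1] at hg
      rw [dist_comm (f • z) z, dist_comm _ z] at ih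
      rw [dist_comm (f • z) z] at hg h
      linarith
    · linarith

theorem lox_growth {δ : ℝ} (H : DeltaHyperbolic δ X) (hδ : 0 ≤ δ) (hiso : IsometricAction G X)
    (f : G) (z : X) (a : ℝ) (ha : 0 ≤ a) (hd : 2 * a + 3 * (3 * δ + 1) + 1 ≤ dist z (f • z))
    (hg : gromov z (f⁻¹ • z) (f • z) ≤ a) (m : ℕ) : (m : ℝ) ≤ dist z ((f⁻¹) ^ m • z) := by
  induction m with
  | zero => simp
  | succ m ih =>
    have h := lox_aux H hδ hiso f z a ha hd hg m
    have e3 : dist z ((f⁻¹) ^ (m + 1) • z) = dist ((f⁻¹) ^ m • z) (f • z) := by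
      rw [dist_comm, ← hiso f, smul_smul, pow_succ', mul_inv_cancel_left]
    rw [e3]
    unfold gromov at h
    rw [dist_comm (f • z) z, dist_comm _ z] at h
    push_cast
    linarith

theorem lox_cross {δ : ℝ} (H : DeltaHyperbolic δ X) (hδ : 0 ≤ δ) (hiso : IsometricAction G X)
    (f : G) (z : X) (a : ℝ) (ha : 0 ≤ a) (hd : 2 * a + 3 * (3 * δ + 1) + 1 ≤ dist z (f • z))
    (hg : gromov z (f⁻¹ • z) (f • z) ≤ a) (m n : ℕ) :
    gromov z ((f⁻¹) ^ m • z) (f ^ n • z) ≤ a + 2 * (3 * δ + 1) := by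
  rcases n with _ | k
  · have : gromov z ((f⁻¹) ^ m • z) (f ^ 0 • z) = 0 := by
      unfold gromov; simp [dist_comm]
    rw [this]; positivity
  · rcases four_point H hδ z ((f⁻¹) ^ m • z) (f ^ (k + 1) • z) (f • z) with h | h
    · linarith [lox_aux H hδ hiso f z a ha hd hg m]
    · exfalso
      have e0 : dist z (f⁻¹ • z) = dist z (f • z) := by
        rw [← hiso f, smul_inv_smul, dist_comm]
      have h2 := lox_aux H hδ hiso f⁻¹ z a ha (by rw [e0]; exact hd)
        (by rw [gromov_comm, inv_inv]; exact hg) k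
      rw [inv_inv] at h2
      have h3 := lox_aux H hδ hiso f z a ha hd hg m
      have e1 : dist (f ^ (k + 1) • z) (f • z) = dist (f ^ k • z) z := by
        rw [pow_succ', mul_smul, hiso]
      have e2 : dist (f ^ (k + 1) • z) z = dist (f ^ k • z) (f⁻¹ • z) := by
        rw [← hiso f (f ^ k • z), smul_inv_smul, smul_smul, pow_succ']
      unfold gromov at h h2 h3
      rw [e1, e2] at h
      rw [dist_comm (f • z) z] at h h3
      rw [dist_comm (f⁻¹ • z) z, e0] at h2
      linarith

theorem lox_two {δ : ℝ} (H : DeltaHyperbolic δ X) (hδ : 0 ≤ δ)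
    (hC : IsCayleyGraph G (S : Set G) X ι)
    (hgen : Subgroup.closure (S : Set G) = ⊤) {U : Subgroup G}
    (f : G) (hf : f ∈ U) (z : X) (a : ℝ) (ha : 0 ≤ a)
    (hd : 2 * a + 3 * (3 * δ + 1) + 1 ≤ dist z (f • z))
    (hg : gromov z (f⁻¹ • z) (f • z) ≤ a) :
    ∃ p ∈ limitSet X U, ∃ q ∈ limitSet X U, p ≠ q := by
  have hiso := hC.1
  have e0 : dist z (f⁻¹ • z) = dist z (f • z) := by
    rw [← hiso f, smul_inv_smul, dist_comm]
  set D := dist z (ι 1) with hD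
  have hι : ∀ g : G, ι g = g • ι 1 := fun g => by rw [← hC.2.1, mul_one]
  have hDg : ∀ g : G, dist (g • z) (ι g) = D := fun g => by rw [hι, hiso]
  have tends : ∀ g : G, (∀ m : ℕ, (m : ℝ) ≤ dist z (g ^ m • z)) →
      ∀ R : ℝ, ∀ᶠ n in Filter.atTop, R ≤ dist (ι 1) (ι (g ^ n)) := by
    intro g hg R
    filter_upwards [Filter.eventually_ge_atTop ⌈R + 2 * D⌉₊] with n hn
    have h1 : R + 2 * D ≤ n := (Nat.le_ceil _).trans (by exact_mod_cast hn)
    have h2 := hg n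
    have h3 := dist_triangle4 z (ι 1) (ι (g ^ n)) (g ^ n • z)
    rw [dist_comm (ι (g ^ n)), hDg] at h3
    linarith
  have g1 := lox_growth H hδ hiso f z a ha hd hg
  have g2 := lox_growth H hδ hiso f⁻¹ z a ha (by rw [e0]; exact hd)
        (by rw [gromov_comm, inv_inv]; exact hg)
  rw [inv_inv] at g2
  obtain ⟨α, hα, hα0, φ, hφ⟩ := exists_limit_ray hC hgen (fun n => f ^ n) (tends f g2)
  obtain ⟨β, hβ, hβ0, ψ, hψ⟩ := exists_limit_ray hC hgen (fun n => f⁻¹ ^ n) (tends f⁻¹ g1)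
  refine ⟨_, ray_mem_limitSet hC (fun n => U.pow_mem hf n) hα hα0 hφ, _,
    ray_mem_limitSet hC (fun n => U.pow_mem (U.inv_mem hf) n) hβ hβ0 hψ, ?_⟩
  intro hcon
  have hcon : Asymptotic α β := (mk_eq_iff _ _).1 hcon
  obtain ⟨K, hK, -⟩ := hcon
  obtain ⟨k, hk⟩ := exists_nat_gt (K + 4 * (3 * δ + 1) + a + 3 * D)
  have hk0 : (0 : ℝ) ≤ k := by positivity
  have d1 := ray_dist0 hα hk0
  have d2 := ray_dist0 hβ hk0
  rw [hα0] at d1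
  rw [hβ0] at d2
  have p1 := gromov_of_between (hφ k) d1
  have p2 := gromov_of_between (hψ k) d2
  have p3 : (k : ℝ) - K ≤ gromov (ι 1) (α k) (β k) := by
    obtain ⟨_, ⟨r, hr, rfl⟩, hdr⟩ := hK (α k) ⟨k, hk0, rfl⟩
    have hr : 0 ≤ r := hr
    have d3 := ray_dist0 hβ hr
    rw [hβ0] at d3
    have hr' := hβ r k hr hk0
    have t1 := dist_triangle (ι 1) (α k) (β r)
    have t2 := dist_triangle (ι 1) (β r) (α k)
    rw [dist_comm (β r) (α k)] at t2
    have : |r - k| ≤ K := by rw [abs_le]; constructor <;> linarith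
    have t3 := dist_triangle (α k) (β r) (β k)
    unfold gromov
    rw [dist_comm _ (ι 1), dist_comm _ (ι 1)]
    linarith
  have hK0 : 0 ≤ K := by
    obtain ⟨b, hb, hd⟩ := hK (α 0) ⟨0, self_mem_Ici, rfl⟩
    exact dist_nonneg.trans hd
  have hx := lox_cross H hδ hiso f z a ha hd hg (ψ k) (φ k)
  have hx' : gromov (ι 1) (ι (f⁻¹ ^ ψ k)) (ι (f ^ φ k)) ≤ a + 2 * (3 * δ + 1) + 3 * D := by
    unfold gromov at hx ⊢
    have q1 := dist_triangle4 (ι (f⁻¹ ^ ψ k)) (f⁻¹ ^ ψ k • z) z (ι 1)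
    have q2 := dist_triangle4 (ι (f ^ φ k)) (f ^ φ k • z) z (ι 1)
    have q3 := dist_triangle4 (f⁻¹ ^ ψ k • z) (ι (f⁻¹ ^ ψ k)) (ι (f ^ φ k)) (f ^ φ k • z)
    rw [dist_comm (ι _) (_ • z), hDg] at q1 q2
    rw [dist_comm (ι (f ^ φ k)) (_ • z), hDg, hDg] at q3
    linarith
  rcases four_point H hδ (ι 1) (ι (f⁻¹ ^ ψ k)) (β k) (ι (f ^ φ k)) with h | h
  · linarith
  · rcases four_point H hδ (ι 1) (β k) (α k) (ι (f ^ φ k)) with h' | h'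
    · rw [gromov_comm] at h'
      linarith
    · rw [gromov_comm _ (α k)] at h'
      linarith [dist_nonneg (x := z) (y := ι 1)]

theorem two_limits {δ : ℝ} (H : DeltaHyperbolic δ X) (hδ : 0 ≤ δ)
    (hC : IsCayleyGraph G (S : Set G) X ι)
    (hgen : Subgroup.closure (S : Set G) = ⊤) (U : Subgroup G) [Infinite U] :
    ∃ p ∈ limitSet X U, ∃ q ∈ limitSet X U, p ≠ q := by
  classical
  have hiso := hC.1
  obtain ⟨u⟩ : Nonempty (ℕ ↪ U) := ⟨Infinite.natEmbedding U⟩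
  have hu : ∀ R : ℝ, ∀ᶠ n in Filter.atTop, R ≤ dist (ι 1) (ι (u n : G)) := by
    intro R
    have hfin := ball_finite hC hgen (ι 1) R
    have hinj : Function.Injective (fun n => (u n : G)) :=
      Subtype.val_injective.comp u.injective
    have := hfin.preimage hinj.injOn
    rw [← Nat.cofinite_eq_atTop]
    filter_upwards [this.compl_mem_cofinite] with n hn
    have : ¬ dist (ι 1) (ι (u n : G)) ≤ R := hn
    linarith
  obtain ⟨α, hα, hα0, φ, hφ⟩ := exists_limit_ray hC hgen (fun n => (u n : G)) hu
  have hmem := ray_mem_limitSet (U := U) hC (fun n => (u n).2) hα hα0 hφ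
  by_cases hall : ∀ v ∈ U, Asymptotic (fun t => v • α t) α
  swap
  · push Not at hall
    obtain ⟨v, hv, hna⟩ := hall
    refine ⟨_, limitSet_smul hiso hv hα hmem, _, hmem, ?_⟩
    intro h
    exact hna ((mk_eq_iff _ _).1 h)
  have hsh : ∀ v : U, ∃ b T : ℝ, ∀ t, T ≤ t → 0 ≤ t + b ∧
      dist ((v : G) • α t) (α (t + b)) ≤ 6 * δ := fun v =>
    asymp_shift H hδ (ray_smul hiso v hα) hα (hall v v.2)
  choose b T hbT using hsh
  set B := 50 * δ + 20 with hB
  by_cases hbig : ∀ v : U, |b v| ≤ B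
  · exfalso
    -- all elements of `U` almost fix far away points
    set k := ⌈B + 6 * δ + 2⌉₊ with hk
    set N := (2 * S.card + 1) ^ k with hN
    obtain ⟨F, hF⟩ := Infinite.exists_subset_card_eq U (N + 1)
    set t := ∑ v ∈ F, |T v| with ht
    have htT : ∀ v ∈ F, T v ≤ t := fun v hv =>
      (le_abs_self _).trans (Finset.single_le_sum (f := fun v => |T v|)
        (fun i _ => abs_nonneg _) hv)
    have ht0 : 0 ≤ t := Finset.sum_nonneg fun i _ => abs_nonneg _
    have := disp_card hC hgen (α t) (B + 6 * δ) k (Nat.le_ceil _)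
      (F.map ⟨Subtype.val, Subtype.val_injective⟩) (by
        intro g hg
        rw [Finset.mem_map] at hg
        obtain ⟨v, hv, rfl⟩ := hg
        obtain ⟨h1, h2⟩ := hbT v t (htT v hv)
        have h3 := hα t (t + b v) ht0 h1
        rw [show t - (t + b v) = - b v by ring, abs_neg] at h3
        have h4 := dist_triangle (α t) (α (t + b v)) ((v : G) • α t)
        rw [dist_comm (α (t + b v)) ((v : G) • α t)] at h4
        have := hbig v
        show dist (α t) ((v : G) • α t) ≤ _
        linarith)
    rw [Finset.card_map, hF] at this
    omega
  · push Not at hbig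
    obtain ⟨v, hv⟩ := hbig
    set t := |T v| + |b v| with ht
    have hT := le_abs_self (T v)
    have hb1 := le_abs_self (b v)
    have hb2 := neg_abs_le (b v)
    have hT0 := abs_nonneg (T v)
    obtain ⟨h1, h2⟩ := hbT v t (by linarith)
    obtain ⟨h3, h4⟩ := hbT v (t - b v) (by linarith)
    rw [sub_add_cancel] at h3 h4
    have e1 := hα t (t + b v) h3 h1
    have e2 := hα (t - b v) t (by linarith) h3
    have e3 := hα (t - b v) (t + b v) (by linarith) h1
    rw [show t - (t + b v) = - b v by ring, abs_neg] at e1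
    rw [show t - b v - t = - b v by ring, abs_neg] at e2
    rw [show t - b v - (t + b v) = - (2 * b v) by ring, abs_neg, abs_mul, abs_two] at e3
    have h5 : dist (α (t - b v)) ((v : G)⁻¹ • α t) ≤ 6 * δ := by
      rw [← hiso (v : G), smul_inv_smul]; exact h4
    have t1 := dist_triangle (α t) ((v : G) • α t) (α (t + b v))
    have t1' := dist_triangle (α t) (α (t + b v)) ((v : G) • α t)
    have t2 := dist_triangle ((v : G)⁻¹ • α t) (α (t - b v)) (α t)
    have t3 := dist_triangle4 (α (t - b v)) ((v : G)⁻¹ • α t) ((v : G) • α t) (α (t + b v))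
    rw [dist_comm (α (t + b v)) ((v : G) • α t)] at t1'
    rw [dist_comm ((v : G)⁻¹ • α t) (α (t - b v))] at t2
    refine lox_two H hδ hC hgen (v : G) v.2 (α t) (12 * δ) (by positivity) (by linarith) ?_
    unfold gromov
    rw [dist_comm ((v : G) • α t) (α t)]
    linarith

end Lam

section Weak
variable {G X : Type*} [Group G] [MetricSpace X] [MulAction G X] {S : Finset G} {ι : G → X}

theorem bi_rayR {γ : ℝ → X} (h : IsBiGeodesic γ) : IsGeodesicRay γ := fun s t _ _ => h s t

theorem bi_neg {γ : ℝ → X} (h : IsBiGeodesic γ) : IsBiGeodesic (fun t => γ (-t)) :=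
  fun s t => by
    rw [h]
    rw [show -s - -t = -(s - t) by ring, abs_neg]

theorem bi_shift {γ : ℝ → X} (h : IsBiGeodesic γ) (a : ℝ) : IsBiGeodesic (fun t => γ (t + a)) :=
  fun s t => by
    rw [h]
    rw [show s + a - (t + a) = s - t by ring]

theorem asymp_bi_shift {γ : ℝ → X} (h : IsBiGeodesic γ) (a : ℝ) :
    Asymptotic γ (fun t => γ (t + a)) := by
  refine ⟨|a|, ?_, ?_⟩
  · rintro _ ⟨t, ht, rfl⟩
    refine ⟨_, ⟨t, ht, rfl⟩, ?_⟩
    show dist (γ t) (γ (t + a)) ≤ |a|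
    rw [h, sub_add_cancel_left, abs_neg]
  · rintro _ ⟨t, ht, rfl⟩
    refine ⟨_, ⟨t, ht, rfl⟩, ?_⟩
    show dist (γ t) (γ (t + a)) ≤ |a|
    rw [h, sub_add_cancel_left, abs_neg]

theorem ray_conv {γ : ℝ → X} (h : IsGeodesicRay γ) :
    SeqConvTo (γ 0) (fun n => γ (n : ℝ)) (Boundary.mk ⟨γ, h⟩) := by
  refine ⟨⟨γ, h⟩, rfl, fun M => ?_⟩
  obtain ⟨N, hN⟩ := exists_nat_ge M
  refine ⟨N, fun n hn m hm => ?_⟩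
  have hn' : (N : ℝ) ≤ n := by exact_mod_cast hn
  have hm' : (N : ℝ) ≤ m := by exact_mod_cast hm
  have e1 := ray_dist0 h (Nat.cast_nonneg n)
  have e2 := ray_dist0 h (Nat.cast_nonneg m)
  have e3 := h n m (Nat.cast_nonneg n) (Nat.cast_nonneg m)
  unfold gromov
  show M ≤ (dist (γ n) (γ 0) + dist (γ m) (γ 0) - dist (γ n) (γ m)) / 2
  rw [dist_comm (γ n) (γ 0), dist_comm (γ m) (γ 0), e1, e2, e3]
  rcases abs_cases ((n : ℝ) - m) with h | h <;> linarith

theorem rayTo_of_conv {δ : ℝ} (H : DeltaHyperbolic δ X) (hδ : 0 ≤ δ) {γ : ℝ → X}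
    (h : IsGeodesicRay γ) {p : Boundary X} (hp : SeqConvTo (γ 0) (fun n => γ (n : ℝ)) p) :
    RayTo γ p := by
  obtain ⟨β, hβ, hc⟩ := hp
  refine ⟨h, ?_⟩
  rw [← hβ]
  exact (mk_eq_iff _ _).2 (asymp_of_gromov H hδ h β.2 (γ 0) hc)

/-- The ray ends in the limit set of `U`. -/
def LR (U : Subgroup G) (γ : ℝ → X) : Prop :=
  ∃ h : IsGeodesicRay γ, Boundary.mk ⟨γ, h⟩ ∈ limitSet X U

theorem LR_asymp {U : Subgroup G} {γ γ' : ℝ → X} (h : LR U γ) (h' : IsGeodesicRay γ')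
    (ha : Asymptotic γ γ') : LR U γ' := by
  obtain ⟨h1, h2⟩ := h
  refine ⟨h', ?_⟩
  have : Boundary.mk (⟨γ, h1⟩ : GRay X) = Boundary.mk ⟨γ', h'⟩ := (mk_eq_iff _ _).2 ha
  rwa [← this]

theorem LR_smul (hiso : IsometricAction G X) {U : Subgroup G} {u : G} (hu : u ∈ U)
    {γ : ℝ → X} (h : LR U γ) : LR U (fun t => u • γ t) := by
  obtain ⟨h1, h2⟩ := h
  exact ⟨ray_smul hiso u h1, limitSet_smul hiso hu h1 h2⟩

theorem weak_of_bi {U : Subgroup G} {γ : ℝ → X} (h : IsBiGeodesic γ)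
    (h1 : LR U (fun t => γ (-t))) (h2 : LR U γ) (hn : ¬ Asymptotic (fun t => γ (-t)) γ) (t : ℝ) :
    γ t ∈ weakHull X U := by
  obtain ⟨r1, m1⟩ := h1
  obtain ⟨r2, m2⟩ := h2
  refine Or.inr ⟨_, ⟨_, m1, rfl⟩, _, ⟨_, m2, rfl⟩, ?_, range γ, ⟨γ, ⟨h, ?_, ?_⟩, rfl⟩, ⟨t, rfl⟩⟩
  · intro he
    exact hn ((mk_eq_iff _ _).1 (Sum.inr_injective he))
  · have := ray_conv r1
    simpa using this
  · exact ray_conv r2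

theorem bi_of_joins {δ : ℝ} (H : DeltaHyperbolic δ X) (hδ : 0 ≤ δ) {U : Subgroup G} {γ : ℝ → X}
    {p q : Boundary X} (hp : p ∈ limitSet X U) (hq : q ∈ limitSet X U) (hpq : p ≠ q)
    (h : BiGeodesicJoins γ p q) : IsBiGeodesic γ ∧ LR U (fun t => γ (-t)) ∧ LR U γ ∧
      ¬ Asymptotic (fun t => γ (-t)) γ := by
  obtain ⟨hb, h1, h2⟩ := h
  obtain ⟨r1, e1⟩ := rayTo_of_conv H hδ (γ := fun t => γ (-t)) (bi_rayR (bi_neg hb))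
    (p := p) (by simpa using h1)
  obtain ⟨r2, e2⟩ := rayTo_of_conv H hδ (bi_rayR hb) h2
  refine ⟨hb, ⟨r1, by rwa [e1]⟩, ⟨r2, by rwa [e2]⟩, fun ha => hpq ?_⟩
  rw [← e1, ← e2]
  exact (mk_eq_iff _ _).2 ha

theorem weak_bi {δ : ℝ} (H : DeltaHyperbolic δ X) (hδ : 0 ≤ δ) {U : Subgroup G} {x : X}
    (hx : x ∈ weakHull X U) : ∃ γ : ℝ → X, IsBiGeodesic γ ∧ γ 0 = x ∧ LR U (fun t => γ (-t)) ∧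
      LR U γ ∧ ¬ Asymptotic (fun t => γ (-t)) γ := by
  rcases hx with ⟨a, ha, -⟩ | ⟨_, ⟨p, hp, rfl⟩, _, ⟨q, hq, rfl⟩, hne, s, ⟨γ, hj, rfl⟩, ⟨a, rfl⟩⟩
  · have : (Sum.inl a : X ⊕ Boundary X) ∈ Sum.inr '' limitSet X U := by rw [ha]; rfl
    obtain ⟨b, -, hb⟩ := this
    cases hb
  · obtain ⟨hb, l1, l2, hna⟩ := bi_of_joins H hδ hp hq (fun h => hne (by rw [h])) hj
    have a1 := asymp_bi_shift hb a
    have a2 := asymp_bi_shift (bi_neg hb) (-a)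
    have e : (fun t => (fun t => γ (-t)) (t + -a)) = fun t => (fun t => γ (t + a)) (-t) := by
      funext t
      show γ (-(t + -a)) = γ (-t + a)
      congr 1; ring
    rw [e] at a2
    refine ⟨fun t => γ (t + a), bi_shift hb a, by simp, LR_asymp l1 ?_ a2,
      LR_asymp l2 (bi_rayR (bi_shift hb a)) a1, fun hn => hna ?_⟩
    · exact bi_rayR (bi_neg (bi_shift hb a))
    · exact asymptotic_trans a2 (asymptotic_trans hn (asymptotic_symm a1))

theorem weak_ray {δ : ℝ} (H : DeltaHyperbolic δ X) (hδ : 0 ≤ δ) {U : Subgroup G} {x : X}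
    (hx : x ∈ weakHull X U) : ∃ γ : ℝ → X, γ 0 = x ∧ LR U γ ∧ ∀ t, γ t ∈ weakHull X U := by
  obtain ⟨γ, hb, h0, l1, l2, hn⟩ := weak_bi H hδ hx
  exact ⟨γ, h0, l2, weak_of_bi hb l1 l2 hn⟩

theorem weak_join {δ : ℝ} (H : DeltaHyperbolic δ X) (hδ : 0 ≤ δ)
    (hC : IsCayleyGraph G (S : Set G) X ι)
    (hgen : Subgroup.closure (S : Set G) = ⊤) {U : Subgroup G} {α β : ℝ → X}
    (hα : LR U α) (hβ : LR U β) (h : ¬ Asymptotic α β) :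
    ∃ γ : ℝ → X, IsBiGeodesic γ ∧ Asymptotic (fun t => γ (-t)) α ∧ Asymptotic γ β ∧
      ∀ t, γ t ∈ weakHull X U := by
  obtain ⟨γ, hb, a1, a2⟩ := exists_bigeodesic H hδ hC hgen hα.1 hβ.1 h
  refine ⟨γ, hb, a1, a2, weak_of_bi hb (LR_asymp hα (bi_rayR (bi_neg hb)) (asymptotic_symm a1))
    (LR_asymp hβ (bi_rayR hb) (asymptotic_symm a2)) fun hn => h ?_⟩
  exact asymptotic_trans (asymptotic_symm a1) (asymptotic_trans hn a2)

theorem weak_ray_to {δ : ℝ} (H : DeltaHyperbolic δ X) (hδ : 0 ≤ δ)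
    (hC : IsCayleyGraph G (S : Set G) X ι)
    (hgen : Subgroup.closure (S : Set G) = ⊤) {U : Subgroup G} [Infinite U] {α : ℝ → X}
    (hα : LR U α) :
    ∃ γ : ℝ → X, IsGeodesicRay γ ∧ Asymptotic γ α ∧ ∀ t, γ t ∈ weakHull X U := by
  have key : ∃ β, LR U β ∧ ¬ Asymptotic β α := by
    obtain ⟨p, hp, q, hq, hpq⟩ := two_limits H hδ hC hgen U
    obtain ⟨a, rfl⟩ := Quotient.exists_rep p
    obtain ⟨b, rfl⟩ := Quotient.exists_rep q
    by_contra hcon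
    push Not at hcon
    have h1 := hcon a.1 ⟨a.2, hp⟩
    have h2 := hcon b.1 ⟨b.2, hq⟩
    exact hpq ((mk_eq_iff a b).2 (asymptotic_trans h1 (asymptotic_symm h2)))
  obtain ⟨β, hβ, hn⟩ := key
  obtain ⟨γ, hb, -, a2, hw⟩ := weak_join H hδ hC hgen hβ hα hn
  exact ⟨γ, bi_rayR hb, a2, hw⟩

theorem weak_nonempty {δ : ℝ} (H : DeltaHyperbolic δ X) (hδ : 0 ≤ δ)
    (hC : IsCayleyGraph G (S : Set G) X ι)
    (hgen : Subgroup.closure (S : Set G) = ⊤) (U : Subgroup G) [Infinite U] :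
    (weakHull X U).Nonempty := by
  obtain ⟨p, hp, -⟩ := two_limits H hδ hC hgen U
  obtain ⟨a, rfl⟩ := Quotient.exists_rep p
  obtain ⟨γ, -, -, hw⟩ := weak_ray_to H hδ hC hgen (U := U) (α := a.1) ⟨a.2, hp⟩
  exact ⟨_, hw 0⟩

theorem weak_smul {δ : ℝ} (H : DeltaHyperbolic δ X) (hδ : 0 ≤ δ) (hiso : IsometricAction G X)
    {U : Subgroup G} {u : G} (hu : u ∈ U) {x : X} (hx : x ∈ weakHull X U) :
    u • x ∈ weakHull X U := by
  obtain ⟨γ, hb, h0, l1, l2, hn⟩ := weak_bi H hδ hx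
  rw [← h0]
  refine weak_of_bi (γ := fun t => u • γ t) (fun s t => by rw [hiso]; exact hb s t)
    (LR_smul hiso hu l1) (LR_smul hiso hu l2) (fun ha => hn ?_) 0
  have := asymp_smul hiso u⁻¹ ha
  simpa using this

theorem weak_qc {δ : ℝ} (H : DeltaHyperbolic δ X) (hδ : 0 ≤ δ)
    (hC : IsCayleyGraph G (S : Set G) X ι)
    (hgen : Subgroup.closure (S : Set G) = ⊤) {U : Subgroup G} {x y p : X}
    (hx : x ∈ weakHull X U) (hy : y ∈ weakHull X U) {s : Set X} (hs : IsGeodesicSegment s x y)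
    (hp : p ∈ s) : ∃ w ∈ weakHull X U, dist p w ≤ 3 * δ := by
  obtain ⟨α, hα0, hα, hαw⟩ := weak_ray H hδ hx
  obtain ⟨β, hβ0, hβ, hβw⟩ := weak_ray H hδ hy
  by_cases ha : Asymptotic α β
  · rw [← hα0, ← hβ0] at hs
    obtain ⟨q, hq, hd⟩ := asymp_thin H hδ hα.1 hβ.1 ha hs hp
    refine ⟨q, ?_, by linarith⟩
    rcases hq with ⟨t, -, rfl⟩ | ⟨t, -, rfl⟩
    · exact hαw t
    · exact hβw t
  · obtain ⟨γ, hb, a1, a2, hw⟩ := weak_join H hδ hC hgen hα hβ ha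
    obtain ⟨s1, hs1⟩ := H.1 (γ 0) y
    obtain ⟨s2, hs2⟩ := H.1 x (γ 0)
    obtain ⟨q, hq, hd⟩ := H.2 x y (γ 0) s s1 s2 hs (seg_symm hs1) hs2 p hp
    rcases hq with hq | hq
    · rw [← hβ0] at hs1
      obtain ⟨r, hr, hd'⟩ := asymp_thin H hδ (bi_rayR hb) hβ.1 a2 hs1 hq
      refine ⟨r, ?_, by linarith [dist_triangle p q r]⟩
      rcases hr with ⟨t, -, rfl⟩ | ⟨t, -, rfl⟩
      · exact hw t
      · exact hβw t
    · rw [← hα0] at hs2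
      have hs3 : IsGeodesicSegment s2 (α 0) ((fun t => γ (-t)) 0) := by simpa using hs2
      obtain ⟨r, hr, hd'⟩ := asymp_thin H hδ hα.1 (bi_rayR (bi_neg hb)) (asymptotic_symm a1)
        hs3 hq
      refine ⟨r, ?_, by linarith [dist_triangle p q r]⟩
      rcases hr with ⟨t, -, rfl⟩ | ⟨t, -, rfl⟩
      · exact hαw t
      · exact hw (-t)

/-- Segments between points near the weak hull stay near it. -/
theorem near_seg {δ : ℝ} (H : DeltaHyperbolic δ X) (hδ : 0 ≤ δ)
    (hC : IsCayleyGraph G (S : Set G) X ι)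
    (hgen : Subgroup.closure (S : Set G) = ⊤) {U : Subgroup G} {R : ℝ} {a b p : X}
    (ha : ∃ w ∈ weakHull X U, dist a w ≤ R) (hb : ∃ w ∈ weakHull X U, dist b w ≤ R)
    {s : Set X} (hs : IsGeodesicSegment s a b) (hp : p ∈ s) :
    ∃ w ∈ weakHull X U, dist p w ≤ R + 5 * δ := by
  obtain ⟨a', ha', da⟩ := ha
  obtain ⟨b', hb', db⟩ := hb
  obtain ⟨s', hs'⟩ := H.1 a' b'
  obtain ⟨q, hq, hd⟩ := quad_max H hs hs' hp hδ da db
  obtain ⟨w, hw, hd'⟩ := weak_qc H hδ hC hgen ha' hb' hs' hq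
  exact ⟨w, hw, by linarith [dist_triangle p q w]⟩

theorem near_ray {δ : ℝ} (H : DeltaHyperbolic δ X) (hδ : 0 ≤ δ)
    (hC : IsCayleyGraph G (S : Set G) X ι)
    (hgen : Subgroup.closure (S : Set G) = ⊤) {U : Subgroup G} [Infinite U] {R : ℝ} {ρ : ℝ → X}
    (hρ : LR U ρ) (ha : ∃ w ∈ weakHull X U, dist (ρ 0) w ≤ R) {t : ℝ} (ht : 0 ≤ t) :
    ∃ w ∈ weakHull X U, dist (ρ t) w ≤ 2 * R + 5 * δ := by
  obtain ⟨σ, hσ, ⟨K, hK1, hK2⟩, hw⟩ := weak_ray_to H hδ hC hgen hρ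
  obtain ⟨a', ha', da⟩ := ha
  have hR : 0 ≤ R := dist_nonneg.trans da
  have hK : 0 ≤ K := by
    obtain ⟨b, -, hb⟩ := hK1 (σ 0) ⟨0, by simp, rfl⟩
    exact dist_nonneg.trans hb
  obtain ⟨b', ⟨r, hr, rfl⟩, db⟩ := hK2 (ρ (t + K + 2 * δ + 1)) ⟨_, by
    show 0 ≤ t + K + 2 * δ + 1
    positivity, rfl⟩
  obtain ⟨s', hs'⟩ := H.1 a' (σ r)
  have hs := ray_seg hρ.1 (a := 0) (b := t + K + 2 * δ + 1) le_rfl (by positivity)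
  rcases quad H hs hs' (p := ρ t) ⟨t, ⟨ht, by linarith⟩, rfl⟩ hδ with ⟨q, hq, hd⟩ | h | h
  · obtain ⟨w, hw', hd'⟩ := weak_qc H hδ hC hgen ha' (hw r) hs' hq
    exact ⟨w, hw', by linarith [dist_triangle (ρ t) q w]⟩
  · exact ⟨a', ha', by linarith [dist_triangle (ρ t) (ρ 0) a']⟩
  · rw [ray_dist hρ.1 ht (by linarith), dist_comm _ (σ r)] at h
    linarith

end Weak

section EStep
variable {G X : Type*} [Group G] [MetricSpace X] [MulAction G X] {S : Finset G} {ι : G → X}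

theorem seg_smul (hiso : IsometricAction G X) (u : G) {s : Set X} {x y : X}
    (h : IsGeodesicSegment s x y) :
    IsGeodesicSegment ((fun z => u • z) '' s) (u • x) (u • y) := by
  obtain ⟨b, f, hb, h0, h1, hf, rfl⟩ := h
  refine ⟨b, fun t => u • f t, hb, by simp only [h0], by simp only [h1], ?_, ?_⟩
  · intro p hp q hq
    rw [hiso]
    exact hf p hp q hq
  · rw [image_image]

theorem dist_pow (hiso : IsometricAction G X) (u : G) (z : X) (k : ℕ) :
    dist z (u ^ k • z) ≤ k * dist z (u • z) := by
  induction k with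
  | zero => simp
  | succ k ih =>
    have h1 := dist_triangle z (u • z) (u ^ (k + 1) • z)
    rw [pow_succ', mul_smul, hiso] at h1
    rw [pow_succ', mul_smul]
    push_cast
    linarith

/-- `y` is a near-projection of `x` to the weak hull. -/
def NP (U : Subgroup G) (x y : X) : Prop :=
  y ∈ weakHull X U ∧ ∀ w ∈ weakHull X U, dist x y ≤ dist x w + 1

theorem exists_NP {U : Subgroup G} (h : (weakHull X U).Nonempty) (x : X) : ∃ y, NP U x y := by
  have : infDist x (weakHull X U) < infDist x (weakHull X U) + 1 := by linarith
  obtain ⟨y, hy, hd⟩ := (infDist_lt_iff h).1 this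
  exact ⟨y, hy, fun w hw => by linarith [infDist_le_dist_of_mem (x := x) hw]⟩

theorem NP_smul {δ : ℝ} (H : DeltaHyperbolic δ X) (hδ : 0 ≤ δ) (hiso : IsometricAction G X)
    {U : Subgroup G} {u : G} (hu : u ∈ U) {x y : X} (h : NP U x y) : NP U (u • x) (u • y) := by
  refine ⟨weak_smul H hδ hiso hu h.1, fun w hw => ?_⟩
  rw [hiso]
  have := h.2 _ (weak_smul H hδ hiso (U.inv_mem hu) hw)
  rwa [← hiso u x (u⁻¹ • w), smul_inv_smul] at this

theorem NP_mid {U : Subgroup G} {x y m : X} {s : Set X} (h : NP U x y)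
    (hs : IsGeodesicSegment s x y) (hm : m ∈ s) : NP U m y := by
  refine ⟨h.1, fun w hw => ?_⟩
  have := h.2 w hw
  have := seg_add hs hm
  linarith [dist_triangle x m w]

theorem e_proj {δ : ℝ} (H : DeltaHyperbolic δ X) (hδ : 1 ≤ δ)
    (hC : IsCayleyGraph G (S : Set G) X ι)
    (hgen : Subgroup.closure (S : Set G) = ⊤) {U : Subgroup G} {u : G} (hu : u ∈ U) {x y : X}
    (hxy : NP U x y) (hd : dist x (u • x) ≤ 100 * δ) :
    dist x y ≤ 106 * δ ∨ dist y (u • y) ≤ 16 * δ := by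
  have hδ0 : 0 ≤ δ := by linarith
  have hxy' := NP_smul H hδ0 hC.1 hu hxy
  obtain ⟨s, hs⟩ := H.1 y (u • y)
  obtain ⟨sx, hsx⟩ := H.1 y x
  obtain ⟨sy, hsy⟩ := H.1 (u • y) (u • x)
  obtain ⟨s', hs'⟩ := H.1 x (u • x)
  obtain ⟨m, hm, hmd⟩ := seg_point hs (t := dist y (u • y) / 2) (by positivity)
    (by linarith [dist_nonneg (x := y) (y := u • y)])
  have hadd := seg_add hs hm
  obtain ⟨w, hw, hwd⟩ := weak_qc H hδ0 hC hgen hxy.1 hxy'.1 hs hm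
  rcases quad_full H hs hsx hsy hs' hm hδ0 with ⟨q, hq, hqd⟩ | ⟨q, hq, hqd⟩ | ⟨q, hq, hqd⟩
  · left
    have h1 := hxy.2 w hw
    have h2 := seg_add hs' hq
    have h3 := dist_triangle4 x q m w
    rw [dist_comm q m] at h3
    have := dist_nonneg (x := q) (y := u • x)
    linarith
  · right
    have h1 := hxy.2 w hw
    have h2 := seg_add (seg_symm hsx) hq
    have h3 := dist_triangle4 x q m w
    have h4 := dist_triangle y q m
    rw [dist_comm q m] at h3 h4
    rw [dist_comm y q] at h4
    linarith
  · right
    have h1 := hxy'.2 w hw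
    have h2 := seg_add (seg_symm hsy) hq
    have h3 := dist_triangle4 (u • x) q m w
    have h4 := dist_triangle m q (u • y)
    rw [dist_comm q m] at h3
    linarith

theorem e_mid {δ : ℝ} (H : DeltaHyperbolic δ X) (hδ : 0 ≤ δ) (hiso : IsometricAction G X)
    {u : G} {x y m : X} (hx : dist x (u • x) ≤ 100 * δ) (hy : dist y (u • y) ≤ 100 * δ)
    {s : Set X} (hs : IsGeodesicSegment s x y) (hm : m ∈ s) : dist m (u • m) ≤ 304 * δ := by
  have hs' := seg_smul hiso u hs
  obtain ⟨q, hq, hd⟩ := quad_max H hs hs' hm hδ hx hy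
  have h1 := seg_dist hs' hq (q := u • m) ⟨m, hm, rfl⟩
  rw [hiso] at h1
  have h2 := dist_triangle4 (u • x) x m q
  have h3 := dist_triangle4 x (u • x) q m
  rw [dist_comm (u • x) x] at h2
  rw [dist_comm q m] at h3
  have h4 : dist q (u • m) ≤ 202 * δ := by
    rw [h1, abs_le]
    constructor <;> linarith
  linarith [dist_triangle m q (u • m)]

theorem cent_card {δ : ℕ} (H : DeltaHyperbolic (δ : ℝ) X) (hδ : 1 ≤ δ)
    (hC : IsCayleyGraph G (S : Set G) X ι)
    (hgen : Subgroup.closure (S : Set G) = ⊤) (F : Subgroup G) (hF : (F : Set G).Finite)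
    (A : Finset G) (hA : ∀ a ∈ A, a ∈ F) : A.card ≤ (2 * S.card + 1) ^ (8 * δ) := by
  obtain ⟨z, hz⟩ := finite_subgroup_point H (Nat.cast_nonneg δ) hC.1 (ι 1) F hF
  refine disp_card hC hgen z _ (8 * δ) ?_ A fun a ha => hz a (hA a ha)
  have : (1 : ℝ) ≤ δ := by exact_mod_cast hδ
  push_cast
  linarith

theorem e_torsion {δ : ℕ} (H : DeltaHyperbolic (δ : ℝ) X) (hδ : 1 ≤ δ)
    (hC : IsCayleyGraph G (S : Set G) X ι)
    (hgen : Subgroup.closure (S : Set G) = ⊤) {u : G}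
    (hF : ((Subgroup.centralizer {u} : Subgroup G) : Set G).Finite) {x y : X}
    (hx : dist x (u • x) ≤ 100 * δ) (hy : dist y (u • y) ≤ 100 * δ) :
    dist x y ≤ 3 * ((2 * S.card + 1 : ℕ) ^ (8 * δ) * (2 * S.card + 1 : ℕ) ^ (306 * δ) : ℕ) := by
  classical
  have hδ1 : (1 : ℝ) ≤ δ := by exact_mod_cast hδ
  obtain ⟨s, hs⟩ := H.1 x y
  have hp : ∀ i : ℕ, ∃ h : G, (i : ℝ) * 3 ≤ dist x y →
      ∃ p ∈ s, dist x p = i * 3 ∧ dist p (ι h) ≤ 1 := by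
    intro i
    by_cases hi : (i : ℝ) * 3 ≤ dist x y
    · obtain ⟨p, hps, hpd⟩ := seg_point hs (by positivity) hi
      obtain ⟨g, hg⟩ := exists_vertex hC p
      exact ⟨g, fun _ => ⟨p, hps, hpd, hg⟩⟩
    · exact ⟨1, fun h => absurd h hi⟩
  choose h hh using hp
  obtain ⟨B, hB, hBm⟩ := ball_card hC hgen (306 * δ)
  set N := ⌊dist x y / 3⌋₊ with hN
  have hle : ∀ i ∈ Finset.range (N + 1), (i : ℝ) * 3 ≤ dist x y := by
    intro i hi
    have h1 : i ≤ N := by simpa [Nat.lt_succ_iff] using hi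
    have h2 : (N : ℝ) ≤ dist x y / 3 := Nat.floor_le (by positivity)
    have h3 : (i : ℝ) ≤ N := by exact_mod_cast h1
    linarith
  have hinj : ∀ i ∈ Finset.range (N + 1), ∀ j ∈ Finset.range (N + 1), h i = h j → i = j := by
    intro i hi j hj hij
    obtain ⟨p, hps, hpd, hpg⟩ := hh i (hle i hi)
    obtain ⟨q, hqs, hqd, hqg⟩ := hh j (hle j hj)
    rw [hij] at hpg
    have h1 := dist_triangle p (ι (h j)) q
    rw [dist_comm (ι (h j)) q, seg_dist hs hps hqs, hpd, hqd] at h1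
    have h2 : |(i : ℝ) * 3 - j * 3| ≤ 2 := by linarith
    rw [abs_le] at h2
    have h3 : (i : ℝ) < j + 1 := by linarith
    have h4 : (j : ℝ) < i + 1 := by linarith
    have h5 : i < j + 1 := by exact_mod_cast h3
    have h6 : j < i + 1 := by exact_mod_cast h4
    omega
  have hmaps : ∀ i ∈ Finset.range (N + 1), (h i)⁻¹ * u * h i ∈ B := by
    intro i hi
    obtain ⟨p, hps, hpd, hpg⟩ := hh i (hle i hi)
    have h1 := e_mid H (by linarith) hC.1 hx hy hs hps
    have h2 := dist_triangle4 (ι (h i)) p (u • p) (u • ι (h i))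
    rw [hC.1, dist_comm _ p] at h2
    have := hBm (h i) (u * h i) (by
      rw [hC.2.1]
      push_cast
      linarith)
    rwa [← mul_assoc] at this
  have hfib : ∀ b ∈ B, ((Finset.range (N + 1)).filter fun i => (h i)⁻¹ * u * h i = b).card
      ≤ (2 * S.card + 1) ^ (8 * δ) := by
    intro b hb
    set Fb := (Finset.range (N + 1)).filter fun i => (h i)⁻¹ * u * h i = b with hFb
    rcases Fb.eq_empty_or_nonempty with he | ⟨j, hj⟩
    · rw [he]; simp
    · have hj' := (Finset.mem_filter.1 hj)
      have hc := cent_card H hδ hC hgen _ hF (Fb.image fun i => h i * (h j)⁻¹) (by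
        intro a ha
        obtain ⟨i, hi, rfl⟩ := Finset.mem_image.1 ha
        have hi' := (Finset.mem_filter.1 hi)
        rw [Subgroup.mem_centralizer_singleton_iff]
        have e1 : u = h i * b * (h i)⁻¹ := by rw [← hi'.2]; group
        have e2 : u = h j * b * (h j)⁻¹ := by rw [← hj'.2]; group
        have e3 : u * (h i * (h j)⁻¹) = h i * b * (h j)⁻¹ := by
          conv_lhs => rw [e1]
          group
        have e4 : (h i * (h j)⁻¹) * u = h i * b * (h j)⁻¹ := by
          conv_lhs => rw [e2]
          group
        rw [e3, e4])
      rwa [Finset.card_image_of_injOn] at hc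
      intro i hi k hk hik
      exact hinj i (Finset.mem_filter.1 hi).1 k (Finset.mem_filter.1 hk).1
        (mul_right_cancel hik)
  have hcard := Finset.card_le_mul_card_image_of_maps_to hmaps _ hfib
  rw [Finset.card_range] at hcard
  have h1 : N + 1 ≤ (2 * S.card + 1) ^ (8 * δ) * (2 * S.card + 1) ^ (306 * δ) :=
    hcard.trans (Nat.mul_le_mul_left _ hB)
  have h2 : dist x y / 3 < N + 1 := Nat.lt_floor_add_one _
  have h3 : ((N + 1 : ℕ) : ℝ) ≤ ((2 * S.card + 1 : ℕ) ^ (8 * δ) * (2 * S.card + 1 : ℕ) ^ (306 * δ) : ℕ) := by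
    exact_mod_cast h1
  push_cast at h3 ⊢
  linarith

theorem e_inf {δ : ℕ} (H : DeltaHyperbolic (δ : ℝ) X) (hδ : 1 ≤ δ)
    (hC : IsCayleyGraph G (S : Set G) X ι)
    (hgen : Subgroup.closure (S : Set G) = ⊤) {U : Subgroup G} {u : G} (hu : u ∈ U)
    (hF : ¬ IsOfFinOrder u) {x y : X} (hxy : NP U x y)
    (hx : dist x (u • x) ≤ 100 * δ) (hy : dist y (u • y) ≤ 100 * δ) :
    dist x y ≤ 200 * δ * ((2 * S.card + 1 : ℕ) ^ (7 * δ) : ℕ) + 4 * δ := by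
  have hδ1 : (1 : ℝ) ≤ δ := by exact_mod_cast hδ
  have hδ0 : (0 : ℝ) ≤ δ := by linarith
  by_contra hcon
  push Not at hcon
  set K := (2 * S.card + 1 : ℕ) ^ (7 * δ) with hK
  obtain ⟨s, hs⟩ := H.1 x y
  obtain ⟨m, hm, hmd⟩ := seg_point hs (t := dist x y / 2) (by positivity)
    (by linarith [dist_nonneg (x := x) (y := y)])
  have hadd := seg_add hs hm
  have hmy := NP_mid hxy hs hm
  have main : ∀ k ≤ K, dist m (u ^ k • m) ≤ 5 * δ := by
    intro k hk
    have hk' : (k : ℝ) ≤ K := by exact_mod_cast hk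
    have bd : (k : ℝ) * (100 * δ) ≤ K * (100 * δ) := by gcongr
    have hx' : dist x (u ^ k • x) ≤ K * (100 * δ) :=
      (dist_pow hC.1 u x k).trans ((mul_le_mul_of_nonneg_left hx (by positivity)).trans bd)
    have hy' : dist y (u ^ k • y) ≤ K * (100 * δ) :=
      (dist_pow hC.1 u y k).trans ((mul_le_mul_of_nonneg_left hy (by positivity)).trans bd)
    have hs' := seg_smul hC.1 (u ^ k) hs
    have hNP' := NP_smul H hδ0 hC.1 (U.pow_mem hu k) hxy
    rcases quad H hs hs' hm hδ0 with ⟨q, hq, hd⟩ | h | h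
    · have hNq := NP_mid hNP' hs' hq
      have h1 := hNq.2 y hxy.1
      have h2 := hmy.2 _ hNq.1
      have h3 := dist_triangle q m y
      have h4 := dist_triangle m q (u ^ k • y)
      rw [dist_comm q m] at h3
      have h5 := seg_dist (seg_symm hs') hq (q := u ^ k • m) ⟨m, hm, rfl⟩
      rw [hC.1, dist_comm _ q, dist_comm y m] at h5
      have h6 : dist q (u ^ k • m) ≤ 2 * δ + 1 := by
        rw [h5, abs_le]
        constructor <;> linarith
      linarith [dist_triangle m q (u ^ k • m)]
    · exfalso
      rw [dist_comm m x] at h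
      linarith
    · exfalso
      linarith
  have hinj : Function.Injective fun k : ℕ => u ^ k := by
    rwa [injective_pow_iff_not_isOfFinOrder]
  have := disp_card hC hgen m (5 * δ) (7 * δ) (by push_cast; linarith)
    ((Finset.range (K + 1)).map ⟨_, hinj⟩) (by
      intro g hg
      obtain ⟨k, hk, rfl⟩ := Finset.mem_map.1 hg
      exact main k (by simpa [Nat.lt_succ_iff] using hk))
  rw [Finset.card_map, Finset.card_range] at this
  omega

/-- The constant bounding the distance from the small displacement set to the weak hull. -/
def RZ (n δ : ℕ) : ℝ := 106 * δ + 3 * ((2 * n + 1 : ℕ) ^ (8 * δ) * (2 * n + 1 : ℕ) ^ (306 * δ) : ℕ)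
  + (200 * δ * ((2 * n + 1 : ℕ) ^ (7 * δ) : ℕ) + 4 * δ)

theorem RZ_nonneg (n δ : ℕ) : 0 ≤ RZ n δ := by unfold RZ; positivity

theorem e_step {δ : ℕ} (H : DeltaHyperbolic (δ : ℝ) X) (hδ : 1 ≤ δ)
    (hC : IsCayleyGraph G (S : Set G) X ι)
    (hgen : Subgroup.closure (S : Set G) = ⊤) (hA : AlmostTorsionFree G)
    {U : Subgroup G} [Infinite U] {x : X} (hx : x ∈ smallDispSet X (δ : ℝ) U) :
    ∃ w ∈ weakHull X U, dist x w ≤ RZ S.card δ := by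
  have hδ1 : (1 : ℝ) ≤ δ := by exact_mod_cast hδ
  have hδ0 : (0 : ℝ) ≤ δ := by linarith
  obtain ⟨u, hu, hu1, hd⟩ := hx
  obtain ⟨y, hxy⟩ := exists_NP (weak_nonempty H hδ0 hC hgen U) x
  refine ⟨y, hxy.1, ?_⟩
  have n1 : (0 : ℝ) ≤ 106 * δ := by positivity
  have n2 : (0 : ℝ) ≤ 3 * ((2 * S.card + 1 : ℕ) ^ (8 * δ) * (2 * S.card + 1 : ℕ) ^ (306 * δ) : ℕ) := by
    positivity
  have n3 : (0 : ℝ) ≤ 200 * δ * ((2 * S.card + 1 : ℕ) ^ (7 * δ) : ℕ) + 4 * δ := by positivity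
  unfold RZ
  rcases e_proj H hδ1 hC hgen hu hxy hd with h | h
  · linarith
  · have hy : dist y (u • y) ≤ 100 * δ := by linarith
    by_cases hf : IsOfFinOrder u
    · have := e_torsion H hδ hC hgen (hA u hu1 hf) hd hy
      linarith
    · have := e_inf H hδ hC hgen hu hf hxy hd hy
      linarith

theorem z_near {δ : ℕ} (H : DeltaHyperbolic (δ : ℝ) X) (hδ : 1 ≤ δ)
    (hC : IsCayleyGraph G (S : Set G) X ι)
    (hgen : Subgroup.closure (S : Set G) = ⊤) (hA : AlmostTorsionFree G)
    {U : Subgroup G} [Infinite U] {x : X} (hx : x ∈ ZSet X (δ : ℝ) U) :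
    ∃ w ∈ weakHull X U, dist x w ≤ 2 * RZ S.card δ + 5 * δ := by
  have hδ0 : (0 : ℝ) ≤ δ := by positivity
  have hR := RZ_nonneg S.card δ
  have hray : ∀ (γ : ℝ → X) (y : X) (p : Boundary X), γ 0 = y → RayTo γ p →
      x ∈ γ '' Ici 0 → p ∈ limitSet X U → y ∈ smallDispSet X (δ : ℝ) U →
      ∃ w ∈ weakHull X U, dist x w ≤ 2 * RZ S.card δ + 5 * δ := by
    rintro γ y p rfl ⟨hγ, rfl⟩ ⟨t, ht, rfl⟩ hp hy
    exact near_ray H hδ0 hC hgen ⟨hγ, hp⟩ (e_step H hδ hC hgen hA hy) ht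
  rcases hx with ⟨a, ha, rfl⟩ | ⟨p, hp, q, hq, hne, s, hj, hxs⟩
  · have : (Sum.inl x : X ⊕ Boundary X) ∈
        Sum.inr '' limitSet X U ∪ Sum.inl '' smallDispSet X (δ : ℝ) U := by rw [ha]; rfl
    rcases this with ⟨b, -, hb⟩ | ⟨b, hb, hbx⟩
    · cases hb
    · obtain rfl := Sum.inl_injective hbx
      obtain ⟨w, hw, hd⟩ := e_step H hδ hC hgen hA hb
      exact ⟨w, hw, by linarith⟩
  · rcases hp with ⟨p, hp, rfl⟩ | ⟨p, hp, rfl⟩ <;> rcases hq with ⟨q, hq, rfl⟩ | ⟨q, hq, rfl⟩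
    · exact ⟨x, Or.inr ⟨_, ⟨p, hp, rfl⟩, _, ⟨q, hq, rfl⟩, hne, s, hj, hxs⟩, by
        rw [dist_self]; positivity⟩
    · obtain ⟨γ, h0, hr, rfl⟩ := hj
      exact hray γ q p h0 hr hxs hp hq
    · obtain ⟨γ, h0, hr, rfl⟩ := hj
      exact hray γ p q h0 hr hxs hq hp
    · obtain ⟨w, hw, hd⟩ := near_seg H hδ0 hC hgen (e_step H hδ hC hgen hA hp)
        (e_step H hδ hC hgen hA hq) hj hxs
      exact ⟨w, hw, by linarith⟩

theorem hull_near {δ : ℕ} (H : DeltaHyperbolic (δ : ℝ) X) (hδ : 1 ≤ δ)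
    (hC : IsCayleyGraph G (S : Set G) X ι)
    (hgen : Subgroup.closure (S : Set G) = ⊤) (hA : AlmostTorsionFree G)
    {U : Subgroup G} [Infinite U] {x : X} (hx : x ∈ cHull X (δ : ℝ) U) :
    ∃ w ∈ weakHull X U, dist x w ≤ 2 * RZ S.card δ + 10 * δ + 1 := by
  have hδ0 : (0 : ℝ) ≤ δ := by positivity
  obtain ⟨x', hx', hd'⟩ := Metric.mem_closure_iff.1 hx 1 one_pos
  have key : ∃ w ∈ weakHull X U, dist x' w ≤ 2 * RZ S.card δ + 5 * δ + 5 * δ := by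
    rcases hx' with ⟨a, ha, rfl⟩ | ⟨_, ⟨p, hp, rfl⟩, _, ⟨q, hq, rfl⟩, hne, s, hj, hxs⟩
    · have : (Sum.inl x' : X ⊕ Boundary X) ∈ Sum.inl '' ZSet X (δ : ℝ) U := by rw [ha]; rfl
      obtain ⟨b, hb, hbx⟩ := this
      obtain rfl := Sum.inl_injective hbx
      obtain ⟨w, hw, hd⟩ := z_near H hδ hC hgen hA hb
      exact ⟨w, hw, by linarith⟩
    · exact near_seg H hδ0 hC hgen (z_near H hδ hC hgen hA hp) (z_near H hδ hC hgen hA hq) hj hxs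
  obtain ⟨w, hw, hd⟩ := key
  exact ⟨w, hw, by linarith [dist_triangle x x' w]⟩

theorem weak_sub {δ : ℝ} (H : DeltaHyperbolic δ X) (hδ : 0 ≤ δ) {U : Subgroup G} {x : X}
    (hx : x ∈ weakHull X U) : x ∈ cHull X δ U := by
  have hsub : ∀ z ∈ weakHull X U, z ∈ ZSet X δ U := by
    intro z hz
    rcases hz with ⟨a, ha, -⟩ | ⟨p, hp, q, hq, h⟩
    · have : (Sum.inl a : X ⊕ Boundary X) ∈ Sum.inr '' limitSet X U := by rw [ha]; rfl
      obtain ⟨b, -, hb⟩ := this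
      cases hb
    · exact Or.inr ⟨p, Or.inl hp, q, Or.inl hq, h⟩
  obtain ⟨γ, h0, hl, hw⟩ := weak_ray H hδ hx
  refine subset_closure (Or.inr ⟨_, ⟨x, hsub x hx, rfl⟩, _, ⟨γ 1, hsub _ (hw 1), rfl⟩, ?_, ?_⟩)
  · intro he
    have he := Sum.inl_injective he
    have := ray_dist0 hl.1 zero_le_one
    rw [h0, ← he, dist_self] at this
    exact zero_ne_one this
  · obtain ⟨s, hs⟩ := H.1 x (γ 1)
    exact ⟨s, hs, seg_left hs⟩

end EStep

theorem statement13 (n δ : ℕ) (hn : 1 ≤ n) (hδ : 1 ≤ δ) :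
    ∃ c : ℝ, 0 ≤ c ∧ ∀ (G : Type u) (X : Type v)
      [Group G] [MetricSpace X] [MulAction G X] (S : Finset G) (ι : G → X),
      S.card = n → Subgroup.closure (S : Set G) = ⊤ →
      IsCayleyGraph G (S : Set G) X ι → DeltaHyperbolic (δ : ℝ) X →
      AlmostTorsionFree G →
      ∀ U : Subgroup G, Infinite ↥U →
        HClose c (weakHull X U) (cHull X (δ : ℝ) U) := by
  have hR := RZ_nonneg n δ
  have hc : 0 ≤ 2 * RZ n δ + 10 * δ + 1 := by positivity
  refine ⟨2 * RZ n δ + 10 * δ + 1, hc, ?_⟩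
  intro G X _ _ _ S ι hS hgen hC H hA U hU
  refine ⟨fun a ha => ⟨a, weak_sub H (Nat.cast_nonneg δ) ha, by rwa [dist_self]⟩,
    fun b hb => ?_⟩
  obtain ⟨w, hw, hd⟩ := hull_near H hδ hC hgen hA hb
  rw [hS] at hd
  exact ⟨w, hw, by rwa [dist_comm]⟩

end KW
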